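/- Let G be a normal prefix-recognizable parity game graph over a finite stack alphabet 𝔸 and disjoint finite control-state sets Q_I, Q_II, with 𝔹 = 𝔸 ∪ Q_I ∪ Q_II, and let u₀ be a vertex in the winning region of Player II. Then there is a memoryless winning strategy σ for Player II from u₀ whose graph {(u, σ(u)) : u ∈ V₂} is a prefix-recognizable relation over 𝔹. The analogous statement holds for Player I (with V₁ in place of V₂). -/

import Mathlib

/-- The maximal color occurring infinitely often in the sequence `s` exists and is even. -/
def MaxInfEven (s : ℕ → ℕ) : Prop :=
  ∃ m, Even m ∧ {k | s k = m}.Infinite ∧ ∀ m', {k | s k = m'}.Infinite → m' ≤ m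

/-- The two players of an infinite game. -/
inductive Player
  | one
  | two

/-- The opponent of a player. -/
def Player.other : Player → Player
  | .one => .two
  | .two => .one

/-- A parity game graph: every element of `V` is a vertex, owned by a player,
with edge relation `E` and coloring `color`. -/
structure GameGraph (V : Type) where
  owner : V → Player
  E : V → V → Prop
  color : V → ℕ

/-- The play `π` is won by player `p`: for Player II this means the maximal color
occurring infinitely often is even, for Player I that it is not. -/
def GameGraph.WonBy {V : Type} (G : GameGraph V) (p : Player) (π : ℕ → V) : Prop :=
  match p with
  | .two => MaxInfEven (fun n => G.color (π n))
  | .one => ¬ MaxInfEven (fun n => G.color (π n))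

/-- The finite prefix `π 0, …, π n` of an infinite sequence, as a list. -/
def hist {V : Type} (π : ℕ → V) (n : ℕ) : List V :=
  List.ofFn (fun i : Fin (n + 1) => π i.val)

/-- Finite play prefixes from `u₀` in which player `p` always moves according to
the strategy `σ` (given as a function from nonempty play prefixes to vertices). -/
inductive ConsHist {V : Type} (G : GameGraph V) (p : Player) (σ : List V → V) (u₀ : V) :
    List V → Prop
  | init : ConsHist G p σ u₀ [u₀]
  | ownStep (l : List V) (v : V) : ConsHist G p σ u₀ l → l.getLast? = some v →
      G.owner v = p → ConsHist G p σ u₀ (l ++ [σ l])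
  | oppStep (l : List V) (v w : V) : ConsHist G p σ u₀ l → l.getLast? = some v →
      G.owner v ≠ p → G.E v w → ConsHist G p σ u₀ (l ++ [w])

/-- `σ` is a (legal) strategy for player `p` from `u₀`: at every play prefix from `u₀`
consistent with `σ` and ending in a vertex of `p`, the prescribed move is along an edge. -/
def IsStrategyFrom {V : Type} (G : GameGraph V) (p : Player) (σ : List V → V) (u₀ : V) : Prop :=
  ∀ l v, ConsHist G p σ u₀ l → l.getLast? = some v → G.owner v = p → G.E v (σ l)

/-- `π` is an infinite play from `u₀`. -/
def IsPlayFrom {V : Type} (G : GameGraph V) (u₀ : V) (π : ℕ → V) : Prop :=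
  π 0 = u₀ ∧ ∀ n, G.E (π n) (π (n + 1))

/-- In the play `π`, player `p` always moves according to the strategy `σ`. -/
def ConsistentPlay {V : Type} (G : GameGraph V) (p : Player) (σ : List V → V) (π : ℕ → V) :
    Prop :=
  ∀ n, G.owner (π n) = p → π (n + 1) = σ (hist π n)

/-- `σ` is a winning strategy for player `p` from `u₀`. -/
def WinningStrategyFrom {V : Type} (G : GameGraph V) (p : Player) (σ : List V → V) (u₀ : V) :
    Prop :=
  IsStrategyFrom G p σ u₀ ∧
    ∀ π, IsPlayFrom G u₀ π → ConsistentPlay G p σ π → G.WonBy p π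

/-- The strategy induced by a memoryless strategy `f` (depending only on the last vertex). -/
def liftMemoryless {V : Type} (f : V → V) (u₀ : V) : List V → V :=
  fun l => f (l.getLast?.getD u₀)

/-- The memoryless strategy `f` is a winning strategy for player `p` from `u₀`. -/
def MemorylessWinningFrom {V : Type} (G : GameGraph V) (p : Player) (f : V → V) (u₀ : V) :
    Prop :=
  WinningStrategyFrom G p (liftMemoryless f u₀) u₀

/-- The winning region of player `p`: the vertices from which `p` has a winning strategy. -/
def WinningRegion {V : Type} (G : GameGraph V) (p : Player) : Set V :=
  {u | ∃ σ, WinningStrategyFrom G p σ u}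

/-- A language of finite words over `B` is regular if it is recognized by a
deterministic finite automaton. -/
def RegularLang {B : Type} (L : Set (List B)) : Prop :=
  ∃ (n : ℕ) (s0 : Fin n) (δ : Fin n → B → Fin n) (F : Set (Fin n)),
    ∀ w, w ∈ L ↔ w.foldl δ s0 ∈ F

/-- A relation on finite words over `B` is prefix-recognizable if it is a finite union
of relations `{(w u, w v) | w ∈ W i, u ∈ U i, v ∈ V i}` with regular `U i, V i, W i`. -/
def PrefixRecognizable {B : Type} (R : List B → List B → Prop) : Prop :=
  ∃ (k : ℕ) (U V W : Fin k → Set (List B)),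
    (∀ i, RegularLang (U i) ∧ RegularLang (V i) ∧ RegularLang (W i)) ∧
    ∀ w₁ w₂, R w₁ w₂ ↔ ∃ i, ∃ w ∈ W i, ∃ u ∈ U i, ∃ v ∈ V i, w₁ = w ++ u ∧ w₂ = w ++ v

/-- Encoding of a vertex (stack content `w ∈ A*`, control state `q`) as the word `w q`
over the alphabet `A ⊕ Q`. -/
def encode {A Q : Type} (v : List A × Q) : List (A ⊕ Q) :=
  v.1.map Sum.inl ++ [Sum.inr v.2]

/-- A relation on vertices, viewed as a relation on their encodings. -/
def encRel {A Q : Type} (R : (List A × Q) → (List A × Q) → Prop) :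
    List (A ⊕ Q) → List (A ⊕ Q) → Prop :=
  fun w₁ w₂ => ∃ u v, w₁ = encode u ∧ w₂ = encode v ∧ R u v

/-- A normal prefix-recognizable parity game graph over the stack alphabet `A` and
control states `Q`: the vertices are pairs (stack content, control state), the owner and
the color of a vertex depend only on its control state. (The edge relation is required
to be prefix-recognizable on encodings via a separate hypothesis.) -/
def normalGame {A Q : Type} (qOwner : Q → Player) (qcol : Q → ℕ)
    (E : (List A × Q) → (List A × Q) → Prop) : GameGraph (List A × Q) :=
  ⟨fun v => qOwner v.2, E, fun v => qcol v.2⟩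

/-- A move along an edge from `v` to `w`, starting with color `c`, does not increase any of the
ranks `τ c'` with `c ≤ c'`, and decreases `τ c` if `c` is bad. -/
def Progress {V : Type} (bad : ℕ → Prop) (τ : ℕ → V → Ordinal.{0}) (c : ℕ) (v w : V) : Prop :=
  (∀ c', c ≤ c' → τ c' w ≤ τ c' v) ∧ (bad c → τ c w < τ c v)

/-- The vertices from which the player owning the vertices in `own` can force the next vertex
to lie in `X c`, where `c` is the current color. -/
def forceNext {V : Type} (own : V → Prop) (E : V → V → Prop) (col : V → ℕ) (X : ℕ → Set V) :
    Set V :=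
  {v | (own v → ∃ w, E v w ∧ w ∈ X (col v)) ∧ (¬ own v → ∀ w, E v w → w ∈ X (col v))}

open Classical in
/-- The nested fixpoint describing the vertices from which a player wins the parity game in which
visiting a vertex of color `c ≥ n` ends the play, with a win if the next vertex is in `X c`. -/
def parityFixpoint {V : Type} (own : V → Prop) (E : V → V → Prop) (col : V → ℕ)
    (bad : ℕ → Prop) : ℕ → (ℕ → Set V) → Set V
  | 0, X => forceNext own E col X
  | n + 1, X =>
    if bad n then
      ⋂₀ {Y | parityFixpoint own E col bad n (Function.update X n Y) ⊆ Y}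
    else
      ⋃₀ {Y | Y ⊆ parityFixpoint own E col bad n (Function.update X n Y)}

section ParityFixpoint

variable {V : Type} (own : V → Prop) (E : V → V → Prop) (col : V → ℕ) (bad : ℕ → Prop)

theorem parityFixpoint_mono (n : ℕ) : Monotone (parityFixpoint own E col bad n) := by
  induction n with
  | zero =>
    intro X Y h v hv
    refine ⟨fun ho => ?_, fun ho w hw => h _ (hv.2 ho w hw)⟩
    obtain ⟨w, hw, hX⟩ := hv.1 ho
    exact ⟨w, hw, h _ hX⟩
  | succ n ih =>
    intro X Y h
    have hup : ∀ Z, parityFixpoint own E col bad n (Function.update X n Z) ⊆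
        parityFixpoint own E col bad n (Function.update Y n Z) :=
      fun Z => ih (update_le_update_iff.2 ⟨le_rfl, fun j _ => h j⟩)
    simp only [parityFixpoint]
    split_ifs with hb
    · exact Set.sInter_subset_sInter fun Z hZ => (hup Z).trans hZ
    · exact Set.sUnion_subset_sUnion fun Z hZ => Set.Subset.trans hZ (hup Z)

/-- One step of the fixpoint iteration at level `n`, as a monotone map. -/
def parityStep (n : ℕ) (X : ℕ → Set V) : Set V →o Set V where
  toFun Y := parityFixpoint own E col bad n (Function.update X n Y)
  monotone' := fun _ _ h =>
    parityFixpoint_mono own E col bad n (update_le_update_iff.2 ⟨h, fun _ _ => le_rfl⟩)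

theorem parityFixpoint_succ_of_bad {n : ℕ} (hb : bad n) (X : ℕ → Set V) :
    parityFixpoint own E col bad (n + 1) X = (parityStep own E col bad n X).lfp := by
  simp only [parityFixpoint, if_pos hb]
  rfl

theorem parityFixpoint_succ_of_not_bad {n : ℕ} (hb : ¬ bad n) (X : ℕ → Set V) :
    parityFixpoint own E col bad (n + 1) X = (parityStep own E col bad n X).gfp := by
  simp only [parityFixpoint, if_neg hb]
  rfl

theorem parityFixpoint_compl (n : ℕ) (X : ℕ → Set V) :
    (parityFixpoint own E col bad n X)ᶜ =
      parityFixpoint (fun v => ¬ own v) E col (fun c => ¬ bad c) n (fun c => (X c)ᶜ) := by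
  induction n generalizing X with
  | zero =>
    ext v
    simp only [parityFixpoint, forceNext, Set.mem_compl_iff, Set.mem_ofPred_eq]
    by_cases ho : own v <;> simp [ho]
  | succ n ih =>
    have hup : ∀ Y, (fun c => (Function.update X n Y c)ᶜ) =
        Function.update (fun c => (X c)ᶜ) n Yᶜ := by
      intro Y
      ext c : 1
      by_cases hc : c = n
      · subst hc; simp
      · simp [hc]
    simp only [parityFixpoint]
    by_cases hb : bad n
    · simp only [hb, not_true, if_true, if_false, Set.compl_sInter]
      congr 1
      ext Y
      simp only [Set.mem_image, Set.mem_ofPred_eq]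
      constructor
      · rintro ⟨Z, hZ, rfl⟩
        rw [← hup, ← ih]
        exact Set.compl_subset_compl.2 hZ
      · intro hY
        refine ⟨Yᶜ, ?_, compl_compl Y⟩
        rw [← Set.compl_subset_compl, ih, hup, compl_compl]
        exact hY
    · simp only [hb, not_false_iff, if_true, if_false, Set.compl_sUnion]
      congr 1
      ext Y
      simp only [Set.mem_image, Set.mem_ofPred_eq]
      constructor
      · rintro ⟨Z, hZ, rfl⟩
        rw [← hup, ← ih]
        exact Set.compl_subset_compl.2 hZ
      · intro hY
        refine ⟨Yᶜ, ?_, compl_compl Y⟩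
        rw [← Set.compl_subset_compl, ih, hup, compl_compl]
        exact hY

theorem exists_lt_mem_of_mem_lfpApprox (f : Set V →o Set V) {a : Ordinal.{0}} {v : V}
    (hv : v ∈ OrdinalApprox.lfpApprox f ⊥ a) :
    ∃ b < a, v ∈ f (OrdinalApprox.lfpApprox f ⊥ b) := by
  rw [OrdinalApprox.lfpApprox] at hv
  simpa using hv

/-- Combining an ordinal rank with a family of subordinate ranks lexicographically. -/
theorem exists_lex_rank (α : V → Ordinal.{0}) (ρ : Ordinal.{0} → ℕ → V → Ordinal.{0}) :
    ∃ τ : ℕ → V → Ordinal.{0},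
      (∀ c v w, α w < α v → τ c w < τ c v) ∧
      (∀ c v w, α w = α v → ρ (α v) c w ≤ ρ (α v) c v → τ c w ≤ τ c v) ∧
      (∀ c v w, α w = α v → ρ (α v) c w < ρ (α v) c v → τ c w < τ c v) := by
  obtain ⟨κ, hκ⟩ : ∃ κ : Ordinal.{0}, ∀ c v, ρ (α v) c v < κ := by
    obtain ⟨κ, hκ⟩ := Ordinal.bddAbove_of_small
      (s := Set.range fun x : ℕ × V => ρ (α x.2) x.1 x.2)
    exact ⟨Order.succ κ, fun c v => Order.lt_succ_of_le (hκ ⟨(c, v), rfl⟩)⟩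
  refine ⟨fun c v => κ * α v + ρ (α v) c v, fun c v w h => ?_, fun c v w h hρ => ?_,
    fun c v w h hρ => ?_⟩
  · calc κ * α w + ρ (α w) c w < κ * α w + κ := by gcongr; exact hκ c w
      _ = κ * (α w + 1) := by rw [mul_add, mul_one]
      _ ≤ κ * α v := by gcongr; exact Order.add_one_le_of_lt h
      _ ≤ _ := le_self_add
  · simp only [h]; gcongr
  · simp only [h]; gcongr

/-- The continuation condition for a move from `v` to `w` at level `n` of the fixpoint `S`. -/
def LevelProgress (n : ℕ) (X : ℕ → Set V) (S : Set V) (τ : ℕ → V → Ordinal.{0}) (v w : V) :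
    Prop :=
  (col v < n → w ∈ S ∧ Progress bad τ (col v) v w) ∧ (n ≤ col v → w ∈ X (col v))

theorem exists_rank_parityFixpoint (n : ℕ) (X : ℕ → Set V) :
    ∃ τ : ℕ → V → Ordinal.{0}, (∀ c v, n ≤ c → τ c v = 0) ∧
      parityFixpoint own E col bad n X ⊆
        {v | (own v → ∃ w, E v w ∧
            LevelProgress col bad n X (parityFixpoint own E col bad n X) τ v w) ∧
          (¬ own v → ∀ w, E v w →
            LevelProgress col bad n X (parityFixpoint own E col bad n X) τ v w)} := by
  induction n generalizing X with
  | zero =>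
    refine ⟨fun _ _ => 0, fun _ _ _ => rfl, fun v hv => ⟨fun ho => ?_, fun ho w hw => ?_⟩⟩
    · obtain ⟨w, hw, hX⟩ := hv.1 ho
      exact ⟨w, hw, fun h => absurd h (Nat.not_lt_zero _), fun _ => hX⟩
    · exact ⟨fun h => absurd h (Nat.not_lt_zero _), fun _ => hv.2 ho w hw⟩
  | succ n ih =>
    by_cases hb : bad n
    · rw [parityFixpoint_succ_of_bad own E col bad hb]
      set f := parityStep own E col bad n X with hf
      set A := OrdinalApprox.lfpApprox f ⊥ with hA
      have hAS : ∀ a, f (A a) ⊆ f.lfp := fun a => by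
        rw [← f.map_lfp]
        exact f.monotone (OrdinalApprox.lfpApprox_le_of_mem_fixedPoints f f.map_lfp bot_le a)
      have hex : ∀ v, v ∈ f.lfp → ∃ b, v ∈ f (A b) := by
        intro v hv
        obtain ⟨a, ha⟩ := OrdinalApprox.lfp_mem_range_lfpApprox f
        rw [← ha] at hv
        obtain ⟨b, -, hb⟩ := exists_lt_mem_of_mem_lfpApprox f hv
        exact ⟨b, hb⟩
      choose ρ hρ0 hρ using fun b => ih (Function.update X n (A b))
      let α : V → Ordinal.{0} := fun v => sInf {b | v ∈ f (A b)}
      have hα : ∀ v, v ∈ f.lfp → v ∈ f (A (α v)) := fun v hv => csInf_mem (hex v hv)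
      have hα' : ∀ v b, v ∈ f (A b) → α v ≤ b := fun v b h => csInf_le' h
      obtain ⟨τ, hlt, hle, hlt'⟩ := exists_lex_rank α ρ
      refine ⟨fun c v => if c ≤ n then τ c v else 0, fun c v hc => if_neg (by omega), ?_⟩
      have key : ∀ v ∈ f.lfp, ∀ w,
          LevelProgress col bad n (Function.update X n (A (α v))) (f (A (α v))) (ρ (α v)) v w →
          LevelProgress col bad (n + 1) X f.lfp (fun c v => if c ≤ n then τ c v else 0) v w := by
        intro v hv w h
        refine ⟨fun hc => ?_, fun hc => ?_⟩
        · rcases Nat.lt_succ_iff_lt_or_eq.1 hc with hc | hc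
          · obtain ⟨hw, hp⟩ := h.1 hc
            refine ⟨hAS _ hw, fun c' hc' => ?_, fun hbc => ?_⟩
            · dsimp only
              split_ifs
              · rcases (hα' w _ hw).lt_or_eq with hl | he
                · exact (hlt _ _ _ hl).le
                · exact hle _ _ _ he (hp.1 _ hc')
              · exact le_rfl
            · dsimp only
              rw [if_pos hc.le, if_pos hc.le]
              rcases (hα' w _ hw).lt_or_eq with hl | he
              · exact hlt _ _ _ hl
              · exact hlt' _ _ _ he (hp.2 hbc)
          · have hw := h.2 hc.ge
            rw [hc, Function.update_self] at hw
            obtain ⟨b, hbα, hwb⟩ := exists_lt_mem_of_mem_lfpApprox f hw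
            have hl : α w < α v := (hα' w b hwb).trans_lt hbα
            refine ⟨hAS b hwb, fun c' hc' => ?_, fun hbc => ?_⟩
            · dsimp only
              split_ifs
              · exact (hlt _ _ _ hl).le
              · exact le_rfl
            · dsimp only
              rw [if_pos hc.le, if_pos hc.le]
              exact hlt _ _ _ hl
        · have hw := h.2 (by omega)
          rwa [Function.update_of_ne (by omega)] at hw
      intro v hv
      have h := hρ (α v) (hα v hv)
      refine ⟨fun ho => ?_, fun ho w hw => key v hv w (h.2 ho w hw)⟩
      obtain ⟨w, hw, hl⟩ := h.1 ho
      exact ⟨w, hw, key v hv w hl⟩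
    · rw [parityFixpoint_succ_of_not_bad own E col bad hb]
      set f := parityStep own E col bad n X with hf
      obtain ⟨τ, h0, hτ⟩ := ih (Function.update X n f.gfp)
      refine ⟨τ, fun c v hc => h0 c v (by omega), ?_⟩
      have hfix : parityFixpoint own E col bad n (Function.update X n f.gfp) = f.gfp := f.map_gfp
      rw [hfix] at hτ
      have key : ∀ v w, LevelProgress col bad n (Function.update X n f.gfp) f.gfp τ v w →
          LevelProgress col bad (n + 1) X f.gfp τ v w := by
        intro v w h
        refine ⟨fun hc => ?_, fun hc => ?_⟩
        · rcases Nat.lt_succ_iff_lt_or_eq.1 hc with hc | hc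
          · exact h.1 hc
          · have hw := h.2 hc.ge
            rw [hc, Function.update_self] at hw
            refine ⟨hw, fun c' hc' => ?_, fun hbc => absurd (hc ▸ hbc) hb⟩
            rw [h0 c' w (by omega), h0 c' v (by omega)]
        · have hw := h.2 (by omega)
          rwa [Function.update_of_ne (by omega)] at hw
      intro v hv
      refine ⟨fun ho => ?_, fun ho w hw => key v w ((hτ hv).2 ho w hw)⟩
      obtain ⟨w, hw, hl⟩ := (hτ hv).1 ho
      exact ⟨w, hw, key v w hl⟩

/-- `τ` is a progress measure on `S` for the player owning the vertices in `own`: it certifies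
that this player can stay in `S` and avoid a bad maximal color occurring infinitely often. -/
def IsProgressMeasure (S : Set V) (τ : ℕ → V → Ordinal.{0}) : Prop :=
  ∀ v ∈ S, (own v → ∃ w, E v w ∧ w ∈ S ∧ Progress bad τ (col v) v w) ∧
    (¬ own v → ∀ w, E v w → w ∈ S ∧ Progress bad τ (col v) v w)

/-- Determinacy of parity games with finitely many colors, with progress measures as winning
certificates for both players. -/
theorem exists_isProgressMeasure {n : ℕ} (hn : ∀ v, col v < n) :
    ∃ S : Set V, (∃ τ, IsProgressMeasure own E col bad S τ) ∧
      ∃ τ, IsProgressMeasure (fun v => ¬ own v) E col (fun c => ¬ bad c) Sᶜ τ := by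
  have main : ∀ (own : V → Prop) (bad : ℕ → Prop) (X : ℕ → Set V),
      ∃ τ, IsProgressMeasure own E col bad (parityFixpoint own E col bad n X) τ := by
    intro own bad X
    obtain ⟨τ, -, hτ⟩ := exists_rank_parityFixpoint own E col bad n X
    refine ⟨τ, fun v hv => ⟨fun ho => ?_, fun ho w hw => ((hτ hv).2 ho w hw).1 (hn v)⟩⟩
    obtain ⟨w, hw, hl⟩ := (hτ hv).1 ho
    exact ⟨w, hw, hl.1 (hn v)⟩
  refine ⟨parityFixpoint own E col bad n fun _ => ∅, main _ _ _, ?_⟩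
  rw [parityFixpoint_compl]
  exact main _ _ _

end ParityFixpoint

section LocalGraphs

variable {A P : Type}

/-- Each edge between stack configurations (with the top of the stack first) keeps the stack,
pushes one letter, or pops one letter. -/
def IsLocal (N : List A × P → List A × P → Prop) : Prop :=
  ∀ v w, N v w → w.1 = v.1 ∨ (∃ a, w.1 = a :: v.1) ∨ ∃ a, v.1 = a :: w.1

/-- `Excursion N col z s c s'`: some path of `N` from `(z, s)` stays on stacks extending `z` until
it finally pops to the control state `s'`; the maximal color on it, excluding `s'`, is `c`. -/
inductive Excursion (N : List A × P → List A × P → Prop) (col : P → ℕ) :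
    List A → P → ℕ → P → Prop
  | pop {a z s s'} : N (a :: z, s) (z, s') → Excursion N col (a :: z) s (col s) s'
  | stay {z s s₁ c s'} : N (z, s) (z, s₁) → Excursion N col z s₁ c s' →
      Excursion N col z s (max (col s) c) s'
  | push {a z s s₁ c₁ s₂ c₂ s'} : N (z, s) (a :: z, s₁) → Excursion N col (a :: z) s₁ c₁ s₂ →
      Excursion N col z s₂ c₂ s' → Excursion N col z s (max (col s) (max c₁ c₂)) s'

theorem Progress.trans {V : Type} {bad : ℕ → Prop} {τ : ℕ → V → Ordinal.{0}} {c₁ c₂ : ℕ}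
    {u v w : V} (h₁ : Progress bad τ c₁ u v) (h₂ : Progress bad τ c₂ v w) :
    Progress bad τ (max c₁ c₂) u w := by
  refine ⟨fun c hc => (h₂.1 c (le_of_max_le_right hc)).trans (h₁.1 c (le_of_max_le_left hc)),
    fun hb => ?_⟩
  rcases le_total c₁ c₂ with h | h
  · rw [max_eq_right h] at hb ⊢
    exact (h₂.2 hb).trans_le (h₁.1 _ h)
  · rw [max_eq_left h] at hb ⊢
    exact (h₂.1 _ h).trans_lt (h₁.2 hb)

theorem Excursion.progress {N : List A × P → List A × P → Prop} {col : P → ℕ} {bad : ℕ → Prop}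
    {τ : ℕ → List A × P → Ordinal.{0}} (hN : ∀ v w, N v w → Progress bad τ (col v.2) v w)
    {z : List A} {s s' : P} {c : ℕ} (h : Excursion N col z s c s') :
    Progress bad τ c (z, s) (z.tail, s') := by
  induction h with
  | pop h => exact hN _ _ h
  | stay h _ ih => exact (hN _ _ h).trans ih
  | push h _ _ ih₁ ih₂ => exact (hN _ _ h).trans (ih₁.trans ih₂)

theorem Excursion.exists_col_eq {N : List A × P → List A × P → Prop} {col : P → ℕ}
    {z : List A} {s s' : P} {c : ℕ} (h : Excursion N col z s c s') : ∃ s₀, c = col s₀ := by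
  induction h with
  | @pop _ _ s => exact ⟨s, rfl⟩
  | @stay _ s _ _ _ _ _ ih =>
    obtain ⟨s₀, rfl⟩ := ih
    rcases max_choice (col s) (col s₀) with h | h
    exacts [⟨s, h⟩, ⟨s₀, h⟩]
  | @push _ _ s _ _ _ _ _ _ _ _ ih₁ ih₂ =>
    obtain ⟨s₁, rfl⟩ := ih₁
    obtain ⟨s₂, rfl⟩ := ih₂
    rcases max_choice (col s) (max (col s₁) (col s₂)) with h | h
    · exact ⟨s, h⟩
    · rw [h]
      rcases max_choice (col s₁) (col s₂) with h | h
      exacts [⟨s₁, h⟩, ⟨s₂, h⟩]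

/-- The part of an infinite path up to the first time it drops below the initial stack height is
an excursion. -/
theorem exists_excursion {N : List A × P → List A × P → Prop} {col : P → ℕ} (hloc : IsLocal N)
    {π : ℕ → List A × P} (hπ : ∀ n, N (π n) (π (n + 1))) (n j : ℕ)
    (hge : ∀ i < n, (π j).1.length ≤ (π (j + i)).1.length)
    (hlt : (π (j + n)).1.length < (π j).1.length) :
    ∃ c, Excursion N col (π j).1 (π j).2 c (π (j + n)).2 ∧ (π (j + n)).1 = (π j).1.tail ∧
      (∃ i < n, col (π (j + i)).2 = c) ∧ ∀ i < n, col (π (j + i)).2 ≤ c := by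
  induction n using Nat.strong_induction_on generalizing j with
  | _ n ih =>
    obtain rfl | ⟨n, rfl⟩ : n = 0 ∨ ∃ k, n = k + 1 := by cases n <;> simp
    · simp at hlt
    have hstep := hπ j
    have hshift : ∀ i, j + 1 + i = j + (i + 1) := fun i => by omega
    rcases hloc _ _ hstep with h | ⟨a, h⟩ | ⟨a, h⟩
    · obtain ⟨c, he, ht, ⟨i, hi, hc⟩, hle⟩ := ih n (by omega) (j + 1)
        (fun i hi => by rw [hshift, h]; exact hge _ (by omega)) (by rw [hshift, h]; exact hlt)
      rw [hshift] at he ht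
      rw [h] at he ht
      refine ⟨max (col (π j).2) c, Excursion.stay (s₁ := (π (j + 1)).2) ?_ he, ht, ?_, ?_⟩
      · rwa [show ((π j).1, (π (j + 1)).2) = π (j + 1) from Prod.ext h.symm rfl]
      · rcases max_choice (col (π j).2) c with hm | hm
        · exact ⟨0, by omega, by simp [hm]⟩
        · exact ⟨i + 1, by omega, by rw [← hshift, hc, hm]⟩
      · rintro (_ | i) hi
        · simp
        · rw [← hshift]
          exact (hle i (by omega)).trans (le_max_right _ _)
    · have hex : ∃ m, (π (j + 1 + m)).1.length < (π (j + 1)).1.length :=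
        ⟨n, by rw [hshift, h, List.length_cons]; omega⟩
      classical
      obtain ⟨m, hm, hmin⟩ : ∃ m, (π (j + 1 + m)).1.length < (π (j + 1)).1.length ∧
          ∀ i < m, (π (j + 1)).1.length ≤ (π (j + 1 + i)).1.length :=
        ⟨Nat.find hex, Nat.find_spec hex, fun i hi => not_lt.1 (Nat.find_min hex hi)⟩
      have hmn : m ≤ n := by
        by_contra hcon
        have := hmin n (by omega)
        rw [hshift, h, List.length_cons] at this
        omega
      obtain ⟨c₁, he₁, ht₁, ⟨i₁, hi₁, hc₁⟩, hle₁⟩ := ih m (by omega) (j + 1) hmin hm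
      rw [h, List.tail_cons] at ht₁
      have hmn' : m < n := by
        rcases hmn.lt_or_eq with hl | rfl
        · exact hl
        · rw [← hshift, ht₁] at hlt
          omega
      have hshift₂ : ∀ i, j + 1 + m + i = j + (m + 1 + i) := fun i => by omega
      obtain ⟨c₂, he₂, ht₂, ⟨i₂, hi₂, hc₂⟩, hle₂⟩ := ih (n - m) (by omega) (j + 1 + m)
        (fun i hi => by rw [hshift₂, ht₁]; exact hge _ (by omega))
        (by rw [hshift₂, ht₁]; convert hlt using 4; omega)
      have hend : j + 1 + m + (n - m) = j + (n + 1) := by omega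
      rw [hend, ht₁] at ht₂ he₂
      rw [h] at he₁
      refine ⟨max (col (π j).2) (max c₁ c₂), Excursion.push (a := a) (s₁ := (π (j + 1)).2)
        ?_ he₁ he₂, ht₂, ?_, ?_⟩
      · rw [← h]
        exact hstep
      · rcases max_choice (col (π j).2) (max c₁ c₂) with hm | hm
        · exact ⟨0, by omega, by simp [hm]⟩
        · rw [hm]
          rcases max_choice c₁ c₂ with hm | hm
          · exact ⟨i₁ + 1, by omega, by rw [← hshift, hc₁, hm]⟩
          · exact ⟨m + 1 + i₂, by omega, by rw [← hshift₂, hc₂, hm]⟩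
      · rintro (_ | i) hi
        · simp
        · rcases lt_or_ge i m with hl | hl
          · rw [← hshift]
            exact (hle₁ i hl).trans ((le_max_left _ _).trans (le_max_right _ _))
          · have := hle₂ (i - m) (by omega)
            rw [hshift₂, show m + 1 + (i - m) = i + 1 by omega] at this
            exact this.trans ((le_max_right _ _).trans (le_max_right _ _))
    · have hn : n = 0 := by
        by_contra hn
        have := hge 1 (by omega)
        rw [h, List.length_cons] at this
        omega
      subst hn
      refine ⟨col (π j).2, ?_, by simp [h], ⟨0, by omega, rfl⟩, fun i hi => ?_⟩
      · rw [h]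
        refine Excursion.pop ?_
        rw [← h]
        exact hstep
      · obtain rfl : i = 0 := by omega
        exact le_rfl

/-- An infinite path with maximal recurring color `C` is impossible if single steps and complete
excursions to higher stacks make progress with respect to some ordinal rank `μ`. -/
theorem not_recurring_of_rank {N : List A × P → List A × P → Prop} {col : P → ℕ}
    (hloc : IsLocal N) (μ : List A × P → Ordinal.{0}) (C : ℕ)
    (hstay : ∀ z s s', N (z, s) (z, s') →
      (col s ≤ C → μ (z, s') ≤ μ (z, s)) ∧ (col s = C → μ (z, s') < μ (z, s)))
    (hpush : ∀ z a s s', N (z, s) (a :: z, s') →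
      (col s ≤ C → μ (a :: z, s') ≤ μ (z, s)) ∧ (col s = C → μ (a :: z, s') < μ (z, s)))
    (hexc : ∀ z a s s₁ c s', N (z, s) (a :: z, s₁) → Excursion N col (a :: z) s₁ c s' →
      (max (col s) c ≤ C → μ (z, s') ≤ μ (z, s)) ∧ (max (col s) c = C → μ (z, s') < μ (z, s)))
    {π : ℕ → List A × P} (hπ : ∀ n, N (π n) (π (n + 1))) {K : ℕ}
    (hle : ∀ n, K ≤ n → col (π n).2 ≤ C) (hinf : ∀ n, ∃ m, n ≤ m ∧ col (π m).2 = C) : False := by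
  let low : ℕ → Prop := fun k => ∀ j, k ≤ j → (π k).1.length ≤ (π j).1.length
  have hnext : ∀ k, K ≤ k → low k → ∃ k', k < k' ∧ low k' ∧ μ (π k') ≤ μ (π k) ∧
      ∀ j, k ≤ j → j < k' → col (π j).2 = C → μ (π k') < μ (π k) := by
    intro k hk hlow
    have hstep := hπ k
    have honly : ∀ j, k ≤ j → j < k + 1 → j = k := fun j h₁ h₂ => by omega
    rcases hloc _ _ hstep with h | ⟨a, h⟩ | ⟨a, h⟩
    · have heq : ((π k).1, (π (k + 1)).2) = π (k + 1) := Prod.ext h.symm rfl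
      have h' := hstay (π k).1 (π k).2 (π (k + 1)).2 (by rwa [heq])
      rw [heq] at h'
      refine ⟨k + 1, by omega, fun j hj => by rw [h]; exact hlow j (by omega), h'.1 (hle k hk),
        fun j hj hj' hc => ?_⟩
      rw [honly j hj hj'] at hc
      exact h'.2 hc
    · by_cases hl : low (k + 1)
      · have h' := hpush (π k).1 a (π k).2 (π (k + 1)).2 (by rw [← h]; exact hstep)
        rw [← h] at h'
        refine ⟨k + 1, by omega, hl, h'.1 (hle k hk), fun j hj hj' hc => ?_⟩
        rw [honly j hj hj'] at hc
        exact h'.2 hc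
      · have hex : ∃ m, (π (k + 1 + m)).1.length < (π (k + 1)).1.length := by
          simp only [low, not_forall, not_le] at hl
          obtain ⟨j, hj, hl⟩ := hl
          exact ⟨j - (k + 1), by rwa [Nat.add_sub_cancel' hj]⟩
        classical
        obtain ⟨m, hm, hmin⟩ : ∃ m, (π (k + 1 + m)).1.length < (π (k + 1)).1.length ∧
            ∀ i < m, (π (k + 1)).1.length ≤ (π (k + 1 + i)).1.length :=
          ⟨Nat.find hex, Nat.find_spec hex, fun i hi => not_lt.1 (Nat.find_min hex hi)⟩
        obtain ⟨c, he, ht, ⟨i, hi, hc⟩, hcle⟩ := exists_excursion (col := col) hloc hπ m (k + 1)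
          hmin hm
        rw [h] at he ht
        rw [List.tail_cons] at ht
        have h' := hexc (π k).1 a (π k).2 (π (k + 1)).2 c (π (k + 1 + m)).2
          (by rw [← h]; exact hstep) he
        rw [← ht, Prod.mk.eta, ht, Prod.mk.eta] at h'
        have hmax : max (col (π k).2) c ≤ C := max_le (hle k hk) (hc ▸ hle _ (by omega))
        refine ⟨k + 1 + m, by omega, fun j hj => by rw [ht]; exact hlow j (by omega), h'.1 hmax,
          fun j hj hj' hjc => h'.2 (le_antisymm hmax ?_)⟩
        rcases hj.eq_or_lt with rfl | hj
        · exact hjc ▸ le_max_left _ _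
        · have := hcle (j - (k + 1)) (by omega)
          rw [Nat.add_sub_cancel' hj, hjc] at this
          exact this.trans (le_max_right _ _)
    · have := hlow (k + 1) (by omega)
      rw [h, List.length_cons] at this
      omega
  have hdrop : ∀ d k j, j - k = d → K ≤ k → low k → k ≤ j → col (π j).2 = C →
      ∃ k', K ≤ k' ∧ low k' ∧ μ (π k') < μ (π k) := by
    intro d
    induction d using Nat.strong_induction_on with
    | _ d ih =>
      intro k j hd hk hlow hkj hc
      obtain ⟨k', hkk', hlow', hle', hlt'⟩ := hnext k hk hlow
      rcases lt_or_ge j k' with hj | hj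
      · exact ⟨k', by omega, hlow', hlt' j hkj hj hc⟩
      · obtain ⟨k'', h₁, h₂, h₃⟩ := ih (j - k') (by omega) k' j rfl (by omega) hlow' hj hc
        exact ⟨k'', h₁, h₂, h₃.trans_le hle'⟩
  have hnone : ∀ o : Ordinal.{0}, ∀ k, K ≤ k → low k → μ (π k) = o → False := by
    intro o
    induction o using WellFoundedLT.induction with
    | _ o ih =>
      intro k hk hlow ho
      obtain ⟨j, hj, hc⟩ := hinf k
      obtain ⟨k', h₁, h₂, h₃⟩ := hdrop _ k j rfl hk hlow hj hc
      exact ih _ (ho ▸ h₃) k' h₁ h₂ rfl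
  obtain ⟨k, hk, hmin⟩ := exists_minimalFor_of_wellFoundedLT (fun k => K ≤ k)
    (fun k => (π k).1.length) ⟨K, le_rfl⟩
  refine hnone _ k hk (fun j hj => ?_) rfl
  by_contra hcon
  exact hcon (hmin (le_trans hk hj) (not_le.1 hcon).le)

end LocalGraphs

/-- Every element is dominated by one of finitely many elements with the same label (and with
smaller or equal ordinal coordinates); prescribed finitely many elements may be kept fixed. -/
theorem exists_finite_range_representative {α Λ ι : Type} [Finite Λ] [Finite ι] (lab : α → Λ)
    (vec : α → ι → Ordinal.{0}) {F : Set α} (hF : F.Finite) :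
    ∃ rep : α → α, (Set.range rep).Finite ∧ (∀ y, lab (rep y) = lab y) ∧
      (∀ y, vec (rep y) ≤ vec y) ∧ ∀ y ∈ F, rep y = y := by
  classical
  obtain ⟨B, hB⟩ : ∃ B : Finset α, ∀ y, ∃ x ∈ B, lab x = lab y ∧ vec x ≤ vec y := by
    by_contra! hcon
    obtain ⟨f, -, hf⟩ := exists_seq_of_forall_finset_exists (fun _ : α => True)
      (fun x y => lab x = lab y → ¬ vec x ≤ vec y)
      (fun s _ => (hcon s).imp fun y hy => ⟨trivial, hy⟩)
    have hwqo : WellQuasiOrdered fun p q : Λ × (ι → Ordinal.{0}) => p.1 = q.1 ∧ p.2 ≤ q.2 :=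
      (Finite.wellQuasiOrdered (α := Λ) (· = ·)).prod wellQuasiOrdered_le
    obtain ⟨m, n, hmn, h₁, h₂⟩ := hwqo fun n => (lab (f n), vec (f n))
    exact hf m n hmn h₁ h₂
  choose r hrB hrlab hrvec using hB
  refine ⟨fun y => if y ∈ F then y else r y, (hF.union B.finite_toSet).subset ?_, fun y => ?_,
    fun y => ?_, fun y hy => if_pos hy⟩
  · rintro _ ⟨y, rfl⟩
    dsimp only
    split_ifs with h
    exacts [Or.inl h, Or.inr (hrB y)]
  · dsimp only
    split_ifs
    exacts [rfl, hrlab y]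
  · dsimp only
    split_ifs
    exacts [le_rfl, hrvec y]

section Relabel

variable {A P Λ : Type}

/-- The finite information about a node `r` that is relevant for local paths through it. -/
def nodeLabel (N : List A × P → List A × P → Prop) (col : P → ℕ) (ext : List A → Λ)
    (r : List A) : Λ × Set (P × P) × Set (P × A × P) × Set (P × P) × Set (P × P × P) :=
  (ext r, {x | N (r, x.1) (r, x.2)}, {x | N (r, x.1) (x.2.1 :: r, x.2.2)},
    {x | ∃ a r', r = a :: r' ∧ N (r, x.1) (r', x.2)},
    {x | Excursion N col r x.1 (col x.2.1) x.2.2})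

/-- The node simulated at `z` when each node is replaced by its representative. -/
def repNode (rep : List A → List A) : List A → List A
  | [] => rep []
  | a :: z => rep (a :: repNode rep z)

/-- The local relation moving at each node `z` as `N` does at the node `h z`. -/
def Relabel (N : List A × P → List A × P → Prop) (h : List A → List A) (v w : List A × P) :
    Prop :=
  (w.1 = v.1 ∧ N (h v.1, v.2) (h v.1, w.2)) ∨
    (∃ a, w.1 = a :: v.1 ∧ N (h v.1, v.2) (a :: h v.1, w.2)) ∨
      ∃ a, v.1 = a :: w.1 ∧ ∃ b r, h v.1 = b :: r ∧ N (h v.1, v.2) (r, w.2)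

theorem isLocal_relabel (N : List A × P → List A × P → Prop) (h : List A → List A) :
    IsLocal (Relabel N h) := by
  rintro v w (⟨h, -⟩ | ⟨a, h, -⟩ | ⟨a, h, -⟩)
  exacts [Or.inl h, Or.inr (Or.inl ⟨a, h⟩), Or.inr (Or.inr ⟨a, h⟩)]

theorem relabel_stay {N : List A × P → List A × P → Prop} {h : List A → List A} {z : List A}
    {s s' : P} (hs : Relabel N h (z, s) (z, s')) : N (h z, s) (h z, s') := by
  rcases hs with ⟨-, hs⟩ | ⟨a, hz, -⟩ | ⟨a, hz, -⟩
  · exact hs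
  · simp at hz
  · simp at hz

theorem relabel_push {N : List A × P → List A × P → Prop} {h : List A → List A} {z : List A}
    {a : A} {s s' : P} (hs : Relabel N h (z, s) (a :: z, s')) : N (h z, s) (a :: h z, s') := by
  rcases hs with ⟨hz, -⟩ | ⟨b, hz, hs⟩ | ⟨b, hz, -⟩
  · simp at hz
  · obtain rfl : a = b := by simpa using hz
    exact hs
  · have := congrArg List.length hz
    simp only [List.length_cons] at this
    omega

theorem relabel_pop {N : List A × P → List A × P → Prop} {h : List A → List A} {z : List A}
    {a : A} {s s' : P} (hs : Relabel N h (a :: z, s) (z, s')) :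
    ∃ b r, h (a :: z) = b :: r ∧ N (h (a :: z), s) (r, s') := by
  rcases hs with ⟨hz, -⟩ | ⟨b, hz, -⟩ | ⟨b, -, hs⟩
  · simp at hz
  · have := congrArg List.length hz
    simp only [List.length_cons] at this
    omega
  · exact hs

variable {N : List A × P → List A × P → Prop} {col : P → ℕ} {ext : List A → Λ}
  {rep : List A → List A}

theorem Excursion.of_nodeLabel_eq {r r' : List A}
    (hlab : nodeLabel N col ext r = nodeLabel N col ext r') {s s' : P} {c : ℕ}
    (h : Excursion N col r s c s') : Excursion N col r' s c s' := by
  obtain ⟨s₀, rfl⟩ := h.exists_col_eq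
  simp only [nodeLabel, Prod.mk.injEq] at hlab
  have : (s, s₀, s') ∈ {x : P × P × P | Excursion N col r x.1 (col x.2.1) x.2.2} := h
  rw [hlab.2.2.2.2] at this
  exact this

theorem Excursion.of_relabel (hrep : ∀ y, nodeLabel N col ext (rep y) = nodeLabel N col ext y)
    {z : List A} {s s' : P} {c : ℕ} (h : Excursion (Relabel N (repNode rep)) col z s c s') :
    Excursion N col (repNode rep z) s c s' := by
  induction h with
  | pop h =>
    obtain ⟨b, r, hr, h⟩ := relabel_pop h
    rw [hr] at h ⊢
    exact .pop h
  | stay h _ ih => exact .stay (relabel_stay h) ih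
  | push h _ _ ih₁ ih₂ => exact .push (relabel_push h) (ih₁.of_nodeLabel_eq (hrep _)) ih₂

/-- If `N` makes progress with respect to `τ`, then the recurring maximal color of a path of the
relabelled relation is not bad. -/
theorem relabel_not_recurring {bad : ℕ → Prop} {τ : ℕ → List A × P → Ordinal.{0}}
    (hN : ∀ v w, N v w → Progress bad τ (col v.2) v w)
    (hrep : ∀ y, nodeLabel N col ext (rep y) = nodeLabel N col ext y)
    (hτ : ∀ y s₀ s, τ (col s₀) (rep y, s) ≤ τ (col s₀) (y, s))
    {π : ℕ → List A × P} (hπ : ∀ n, Relabel N (repNode rep) (π n) (π (n + 1))) {C : ℕ}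
    (hbad : bad C) {K : ℕ} (hle : ∀ n, K ≤ n → col (π n).2 ≤ C)
    (hinf : ∀ n, ∃ m, n ≤ m ∧ col (π m).2 = C) : False := by
  obtain ⟨s₀, hs₀⟩ : ∃ s₀, C = col s₀ := (hinf 0).imp' (fun m => (π m).2) fun m hm => hm.2.symm
  have hprog : ∀ {c v w}, Progress bad τ c v w →
      (c ≤ C → τ C w ≤ τ C v) ∧ (c = C → τ C w < τ C v) :=
    fun h => ⟨fun hc => h.1 C hc, fun hc => by subst hc; exact h.2 hbad⟩
  refine not_recurring_of_rank (isLocal_relabel N (repNode rep))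
    (fun v => τ C (repNode rep v.1, v.2)) C (fun z s s' h => hprog (hN _ _ (relabel_stay h)))
    (fun z a s s' h => ?_) (fun z a s s₁ c s' h he => ?_) hπ hle hinf
  · have h' := hprog (hN _ _ (relabel_push h))
    have hle : τ C (repNode rep (a :: z), s') ≤ τ C (a :: repNode rep z, s') := by
      rw [hs₀]
      exact hτ _ _ _
    exact ⟨fun hc => hle.trans (h'.1 hc), fun hc => hle.trans_lt (h'.2 hc)⟩
  · exact hprog ((hN _ _ (relabel_push h)).trans
      (((he.of_relabel hrep).of_nodeLabel_eq (hrep _)).progress hN))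

end Relabel

section Languages

/-- Finitely many regular languages are recognized by a common finite congruence. -/
theorem exists_finite_recognizer {B J : Type} [Finite J] (L : J → Set (List B))
    (hL : ∀ j, RegularLang (L j)) :
    ∃ (M : Type) (_ : Finite M) (η : List B → M) (lm : B → M → M) (rm : M → B → M)
      (F : J → Set M), (∀ b u, η (b :: u) = lm b (η u)) ∧ (∀ b u, η (u ++ [b]) = rm (η u) b) ∧
        ∀ j w, w ∈ L j ↔ η w ∈ F j := by
  choose n s₀ δ F h using hL
  refine ⟨∀ j, Fin (n j) → Fin (n j), inferInstance, fun u j s => u.foldl (δ j) s,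
    fun b f j s => f j (δ j s b), fun f b j s => δ j (f j s) b,
    fun j => {f | f j (s₀ j) ∈ F j}, fun b u => rfl, fun b u => ?_, fun j w => h j w⟩
  funext j s
  simp

theorem regularLang_of_finite_states {B S : Type} [Finite S] (s₀ : S) (δ : S → B → S)
    (F : Set S) : RegularLang {w | w.foldl δ s₀ ∈ F} := by
  obtain ⟨n, ⟨e⟩⟩ := Finite.exists_equiv_fin S
  refine ⟨n, e s₀, fun i b => e (δ (e.symm i) b), e '' F, fun w => ?_⟩
  have : ∀ s, w.foldl (fun i b => e (δ (e.symm i) b)) (e s) = e (w.foldl δ s) := by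
    induction w with
    | nil => intro s; rfl
    | cons b w ih => intro s; simp [ih]
  rw [this]
  simp

theorem regularLang_singleton_nil {B : Type} : RegularLang ({[]} : Set (List B)) := by
  convert regularLang_of_finite_states (B := B) true (fun _ _ => false) {true} using 1
  ext w
  have : ∀ w : List B, w.foldl (fun _ _ => false) false = false := by
    intro w
    induction w with
    | nil => rfl
    | cons b w ih => exact ih
  cases w <;> simp [this]

variable {A Q : Type}

theorem encode_injective : Function.Injective (encode : List A × Q → List (A ⊕ Q)) := by
  rintro ⟨x, q⟩ ⟨y, q'⟩ h
  obtain ⟨h₁, h₂⟩ := List.append_inj' h rfl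
  have h₁ := List.map_injective_iff.2 Sum.inl_injective h₁
  simp_all

/-- The ways to split the encoding of a configuration into two words. -/
theorem encode_eq_append {x : List A} {q : Q} {w u : List (A ⊕ Q)} :
    encode (x, q) = w ++ u ↔ (u = [] ∧ w = encode (x, q)) ∨
      ∃ x₁ x₂, x = x₁ ++ x₂ ∧ w = x₁.map Sum.inl ∧ u = x₂.map Sum.inl ++ [Sum.inr q] := by
  constructor
  · intro h
    rcases List.eq_nil_or_concat u with rfl | ⟨u', b, rfl⟩
    · left
      simp [h]
    · right
      rw [List.concat_eq_append] at h ⊢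
      rw [← List.append_assoc] at h
      obtain ⟨h₁, h₂⟩ := List.append_inj' h rfl
      obtain ⟨x₁, x₂, rfl, rfl, rfl⟩ := List.map_eq_append_iff.1 h₁
      refine ⟨x₁, x₂, rfl, rfl, ?_⟩
      rw [← h₂]
  · rintro (⟨rfl, rfl⟩ | ⟨x₁, x₂, rfl, rfl, rfl⟩)
    · simp
    · simp [encode]

/-- A prefix-recognizable relation on configurations, described by a finite congruence on the
stack contents. -/
theorem exists_finite_description {E : List A × Q → List A × Q → Prop}
    (hpr : PrefixRecognizable (encRel E)) :
    ∃ (M : Type) (_ : Finite M) (η : List A → M) (lm : A → M → M) (rm : M → A → M)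
      (R : M → M → Q → M → Q → Prop), (∀ a u, η (a :: u) = lm a (η u)) ∧
        (∀ a u, η (u ++ [a]) = rm (η u) a) ∧
        ∀ x q y q', E (x, q) (y, q') ↔
          ∃ w u v, x = w ++ u ∧ y = w ++ v ∧ R (η w) (η u) q (η v) q' := by
  obtain ⟨k, U, V, W, hreg, hE⟩ := hpr
  obtain ⟨M, hM, η, lm, rm, F, hlm, hrm, hF⟩ := exists_finite_recognizer
    (Sum.elim (Sum.elim U V) (Sum.elim W fun _ : Unit => {[]})) (by
      rintro ((i | i) | (i | i))
      exacts [(hreg i).1, (hreg i).2.1, (hreg i).2.2, regularLang_singleton_nil])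
  have hU : ∀ i u, u ∈ U i ↔ η u ∈ F (Sum.inl (Sum.inl i)) := fun i => hF (Sum.inl (Sum.inl i))
  have hV : ∀ i u, u ∈ V i ↔ η u ∈ F (Sum.inl (Sum.inr i)) := fun i => hF (Sum.inl (Sum.inr i))
  have hW : ∀ i u, u ∈ W i ↔ η u ∈ F (Sum.inr (Sum.inl i)) := fun i => hF (Sum.inr (Sum.inl i))
  have hnil : ∀ u, u = [] ↔ η u ∈ F (Sum.inr (Sum.inr ())) := hF (Sum.inr (Sum.inr ()))
  refine ⟨M, hM, fun u => η (u.map Sum.inl), fun a => lm (Sum.inl a),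
    fun m a => rm m (Sum.inl a),
    fun mw mu q mv q' =>
      (∃ i, mw ∈ F (Sum.inr (Sum.inl i)) ∧ rm mu (Sum.inr q) ∈ F (Sum.inl (Sum.inl i)) ∧
        rm mv (Sum.inr q') ∈ F (Sum.inl (Sum.inr i))) ∨
      (q = q' ∧ mu ∈ F (Sum.inr (Sum.inr ())) ∧ mv ∈ F (Sum.inr (Sum.inr ())) ∧
        ∃ i, rm mw (Sum.inr q) ∈ F (Sum.inr (Sum.inl i)) ∧ [] ∈ U i ∧ [] ∈ V i),
    fun a u => hlm _ _, fun a u => by simp [hrm], fun x q y q' => ?_⟩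
  have henc : E (x, q) (y, q') ↔ encRel E (encode (x, q)) (encode (y, q')) := by
    constructor
    · exact fun h => ⟨_, _, rfl, rfl, h⟩
    · rintro ⟨v, w, hv, hw, h⟩
      rwa [encode_injective hv, encode_injective hw]
  rw [henc, hE]
  constructor
  · rintro ⟨i, w, hw, u, hu, v, hv, h₁, h₂⟩
    rcases encode_eq_append.1 h₁ with ⟨rfl, rfl⟩ | ⟨x₁, x₂, rfl, rfl, rfl⟩
    · rcases encode_eq_append.1 h₂ with ⟨rfl, h₃⟩ | ⟨y₁, y₂, -, h₃, -⟩
      · obtain ⟨rfl, rfl⟩ : x = y ∧ q = q' := by simpa using encode_injective h₃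
        refine ⟨x, [], [], by simp, by simp, Or.inr ⟨rfl, (hnil _).1 rfl, (hnil _).1 rfl, i, ?_,
          hu, hv⟩⟩
        rw [← hrm]
        exact (hW _ _).1 hw
      · have : Sum.inr q ∈ y₁.map (Sum.inl : A → A ⊕ Q) := h₃ ▸ by simp [encode]
        simp at this
    · rcases encode_eq_append.1 h₂ with ⟨-, h₃⟩ | ⟨y₁, y₂, rfl, h₃, rfl⟩
      · have : Sum.inr q' ∈ x₁.map (Sum.inl : A → A ⊕ Q) := h₃ ▸ by simp [encode]
        simp at this
      · obtain rfl := List.map_injective_iff.2 Sum.inl_injective h₃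
        exact ⟨x₁, x₂, y₂, rfl, rfl, Or.inl ⟨i, (hW _ _).1 hw, hrm _ _ ▸ (hU _ _).1 hu,
          hrm _ _ ▸ (hV _ _).1 hv⟩⟩
  · rintro ⟨w, u, v, rfl, rfl, ⟨i, hw, hu, hv⟩ | ⟨rfl, hu, hv, i, hw, hu', hv'⟩⟩
    · rw [← hrm] at hu hv
      refine ⟨i, w.map Sum.inl, (hW _ _).2 hw, _, (hU _ _).2 hu, _, (hV _ _).2 hv, ?_, ?_⟩ <;>
        simp [encode]
    · rw [← hrm] at hw
      have hu := (hnil _).2 hu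
      have hv := (hnil _).2 hv
      refine ⟨i, _, (hW _ _).2 hw, _, hu', _, hv', ?_, ?_⟩ <;> simp_all [encode]

end Languages

section LocalStrategy

variable {A P : Type}

/-- A finite-state strategy in a local game on configurations: a finite automaton reads the stack
from the bottom to the top, and its state `h z` determines the moves of the player owning the
control states in `own`. The configurations `(z, s)` with `s ∈ K (h z)` are those from which the
strategy is followed, `Step` describes the moves that are possible then, and `ρ` decreases with each
push from a bad control state. -/
structure LocalStrategy {Λ : Type} (E : List A × P → List A × P → Prop) (own : P → Prop)
    (col : P → ℕ) (bad : ℕ → Prop) (ext : List A → Λ) where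
  T : Type
  finite : Finite T
  h : List A → T
  δ : A → T → T
  h_cons : ∀ a z, h (a :: z) = δ a (h z)
  ext_eq : ∀ z z', h z = h z' → ext z = ext z'
  K : T → Set P
  Step : List A × P → List A × P → Prop
  step_edge : ∀ v w, Step v w → E v w
  step_mem : ∀ v w, Step v w → w.2 ∈ K (h w.1)
  ρ : ℕ → T → P → Ordinal.{0}
  opp_step : ∀ z s w, s ∈ K (h z) → ¬ own s → E (z, s) w → Step (z, s) w
  own_step : ∀ t s, s ∈ K t → own s →
    (∃ s', ∀ z, h z = t → Step (z, s) (z, s')) ∨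
    (∃ a s', (bad (col s) → ρ (col s) (δ a t) s' < ρ (col s) t s) ∧
      ∀ z, h z = t → Step (z, s) (a :: z, s')) ∨
    ∃ s', ∀ z, h z = t → ∃ a z', z = a :: z' ∧ Step (z, s) (z', s')
  not_recurring : ∀ (π : ℕ → List A × P) (C K : ℕ), (∀ n, Step (π n) (π (n + 1))) → bad C →
    (∀ n, K ≤ n → col (π n).2 ≤ C) → (∀ n, ∃ m, n ≤ m ∧ col (π m).2 = C) → False

theorem Excursion.mem_of_forall {N : List A × P → List A × P → Prop} {col : P → ℕ}
    {S : Set (List A × P)} (hN : ∀ v w, N v w → w ∈ S) {z : List A} {s s' : P} {c : ℕ}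
    (h : Excursion N col z s c s') : (z.tail, s') ∈ S := by
  induction h with
  | pop h => exact hN _ _ h
  | stay _ _ ih => exact ih
  | push _ _ _ _ ih => exact ih

theorem repNode_cons (rep : List A → List A) (a : A) (z : List A) :
    repNode rep (a :: z) = rep (a :: repNode rep z) := rfl

theorem repNode_eq_self {rep : List A → List A} {z : List A} (h : ∀ y, y <:+ z → rep y = y) :
    repNode rep z = z := by
  induction z with
  | nil => exact h _ (List.suffix_refl _)
  | cons a z ih =>
    rw [repNode_cons, ih fun y hy => h y (hy.trans (List.suffix_cons a z)),
      h _ (List.suffix_refl _)]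

theorem repNode_mem_range (rep : List A → List A) (z : List A) :
    repNode rep z ∈ Set.range rep := by
  cases z with
  | nil => exact ⟨_, rfl⟩
  | cons a z => exact ⟨_, rfl⟩

/-- A progress measure on a local game whose moves depend only on a finite labelling of the stacks
gives a finite-state strategy. -/
theorem exists_localStrategy {Λ : Type} [Finite A] [Finite P] [Finite Λ]
    {E : List A × P → List A × P → Prop} {own : P → Prop} {col : P → ℕ} {bad : ℕ → Prop}
    {ext : List A → Λ} {S : Set (List A × P)} {τ : ℕ → List A × P → Ordinal.{0}}
    (hS : IsProgressMeasure (fun v => own v.2) E (fun v => col v.2) bad S τ)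
    (hloc : IsLocal E) (hnil : ∀ a z, ext (a :: z) ≠ ext [])
    (hcons : ∀ a z z', ext z = ext z' → ext (a :: z) = ext (a :: z'))
    (hstay : ∀ z z' s s', ext z = ext z' → E (z, s) (z, s') → E (z', s) (z', s'))
    (hpush : ∀ a z z' s s', ext z = ext z' → E (z, s) (a :: z, s') → E (z', s) (a :: z', s'))
    (hpop : ∀ a b z z' s s', ext (a :: z) = ext (b :: z') → E (a :: z, s) (z, s') →
      E (b :: z', s) (z', s'))
    {z₀ : List A} {s₀ : P} (h₀ : (z₀, s₀) ∈ S) :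
    ∃ σ : LocalStrategy E own col bad ext, s₀ ∈ σ.K (σ.h z₀) := by
  let N : List A × P → List A × P → Prop := fun v w =>
    E v w ∧ w ∈ S ∧ Progress bad τ (col v.2) v w
  have hNown : ∀ {v}, v ∈ S → own v.2 → ∃ w, N v w := fun hv ho => (hS _ hv).1 ho
  have hNopp : ∀ {v w}, v ∈ S → ¬ own v.2 → E v w → N v w := fun hv ho hE =>
    ⟨hE, (hS _ hv).2 ho _ hE⟩
  let lab : List A → _ := nodeLabel N col fun r => (ext r, {s | (r, s) ∈ S})
  obtain ⟨rep, hfin, hlab, hvec, hfix⟩ := exists_finite_range_representative lab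
    (fun y (x : P × P) => τ (col x.1) (y, x.2)) (F := {y | y <:+ z₀})
    ((List.finite_toSet z₀.tails).subset fun y hy => (List.mem_tails _ _).2 hy)
  have hext : ∀ y, ext (rep y) = ext y := fun y => congrArg (fun x => x.1.1) (hlab y)
  have hmem : ∀ y s, (rep y, s) ∈ S ↔ (y, s) ∈ S := fun y s => by
    have := congrArg (fun x => x.1.2) (hlab y)
    exact Set.ext_iff.1 this s
  let h := repNode rep
  have hexth : ∀ z, ext (h z) = ext z := by
    intro z
    induction z with
    | nil => exact hext _
    | cons a z ih => exact (hext _).trans (hcons _ _ _ ih)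
  have hpopmem : ∀ a z s s' b r, h (a :: z) = b :: r → N (b :: r, s) (r, s') → (h z, s') ∈ S := by
    intro a z s s' b r hr hN
    have hexc : Excursion N col (h (a :: z)) s (col s) s' := hr ▸ .pop hN
    exact (hexc.of_nodeLabel_eq (hlab _)).mem_of_forall fun _ _ h => h.2.1
  have hne : ∀ a z, ∃ b r, h (a :: z) = b :: r := by
    intro a z
    rcases hz : h (a :: z) with _ | ⟨b, r⟩
    · exact (hnil a z (by rw [← hexth, hz])).elim
    · exact ⟨b, r, rfl⟩
  have hrelmem : ∀ v w, Relabel N h v w → (h w.1, w.2) ∈ S := by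
    rintro ⟨z, s⟩ ⟨y, s'⟩ (⟨rfl, hN⟩ | ⟨a, rfl, hN⟩ | ⟨a, rfl, b, r, hr, hN⟩)
    · exact hN.2.1
    · exact (hmem _ _).2 hN.2.1
    · dsimp only at hr hN
      exact hpopmem _ _ _ _ _ _ hr (hr ▸ hN)
  have hreledge : ∀ v w, Relabel N h v w → E v w := by
    rintro ⟨z, s⟩ ⟨y, s'⟩ (⟨rfl, hN⟩ | ⟨a, rfl, hN⟩ | ⟨a, rfl, b, r, hr, hN⟩)
    · exact hstay _ _ _ _ (hexth _) hN.1
    · exact hpush _ _ _ _ _ (hexth _) hN.1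
    · dsimp only at hr hN
      rw [hr] at hN
      exact hpop _ _ _ _ _ _ (hr ▸ hexth _) hN.1
  refine ⟨{
    T := Set.range rep
    finite := hfin
    h := fun z => ⟨h z, repNode_mem_range _ _⟩
    δ := fun a t => ⟨rep (a :: t.1), _, rfl⟩
    h_cons := fun _ _ => rfl
    ext_eq := fun z z' hz => by
      have : h z = h z' := Subtype.ext_iff.1 hz
      rw [← hexth, ← hexth z', this]
    K := fun t => {s | (t.1, s) ∈ S}
    Step := Relabel N h
    step_edge := hreledge
    step_mem := hrelmem
    ρ := fun c t s => τ c (t.1, s)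
    opp_step := ?_
    own_step := ?_
    not_recurring := fun π C K hπ hC hle hinf => relabel_not_recurring (fun _ _ h => h.2.2) hlab
      (fun y s₀ s => hvec y (s₀, s)) hπ hC hle hinf }, ?_⟩
  · rintro z s ⟨y, s'⟩ hs ho hE
    rcases hloc _ _ hE with hy | ⟨a, hy⟩ | ⟨a, hy⟩ <;> dsimp only at hy <;> subst hy
    · exact Or.inl ⟨rfl, hNopp hs ho (hstay _ _ _ _ (hexth _).symm hE)⟩
    · exact Or.inr (Or.inl ⟨a, rfl, hNopp hs ho (hpush _ _ _ _ _ (hexth _).symm hE)⟩)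
    · obtain ⟨b, r, hr⟩ := hne a y
      refine Or.inr (Or.inr ⟨a, rfl, b, r, hr, hNopp hs ho ?_⟩)
      dsimp only
      rw [hr]
      exact hpop _ _ _ _ _ _ (hr ▸ (hexth _).symm) hE
  · rintro t s hs ho
    obtain ⟨⟨y, s'⟩, hN⟩ := hNown hs ho
    rcases hloc _ _ hN.1 with hy | ⟨a, hy⟩ | ⟨a, hy⟩ <;> dsimp only at hy
    · refine Or.inl ⟨s', ?_⟩
      rintro z rfl
      subst hy
      exact Or.inl ⟨rfl, hN⟩
    · subst hy
      refine Or.inr (Or.inl ⟨a, s', fun hb => ?_, ?_⟩)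
      · exact (hvec _ (s, s')).trans_lt (hN.2.2.2 hb)
      · rintro z rfl
        exact Or.inr (Or.inl ⟨a, rfl, hN⟩)
    · refine Or.inr (Or.inr ⟨s', ?_⟩)
      rintro z rfl
      rcases z with _ | ⟨b, z⟩
      · exact (hnil a y (by rw [← hexth [], ← hy])).elim
      · exact ⟨b, z, rfl, Or.inr (Or.inr ⟨b, rfl, a, y, hy, hN⟩)⟩
  · change (h z₀, s₀) ∈ S
    rwa [show h z₀ = z₀ from repNode_eq_self hfix]

end LocalStrategy

section Moves

/-- The control states of the local game simulating a prefix-recognizable game: a move from the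
state `q` first pops a word (whose class is tracked), and then pushes one. -/
inductive MoveState (Q M : Type)
  | main (q : Q)
  | pop (q : Q) (m : M)
  | push (q : Q) (m m' : M) (q' : Q)

variable {A Q M : Type}

/-- The control state from which the simulated move starts. -/
def MoveState.source : MoveState Q M → Q
  | .main q => q
  | .pop q _ => q
  | .push q _ _ _ => q

def MoveState.IsMain (s : MoveState Q M) : Prop := ∃ q, s = .main q

theorem MoveState.not_isMain_pop (q : Q) (m : M) : ¬ (MoveState.pop q m).IsMain := by
  rintro ⟨_, h⟩
  cases h

theorem MoveState.not_isMain_push (q : Q) (m m' : M) (q' : Q) :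
    ¬ (MoveState.push q m m' q').IsMain := by
  rintro ⟨_, h⟩
  cases h

instance [Finite Q] [Finite M] : Finite (MoveState Q M) := by
  let f : MoveState Q M → Q ⊕ (Q × M) ⊕ (Q × M × M × Q) := fun s => match s with
    | .main q => .inl q
    | .pop q m => .inr (.inl (q, m))
    | .push q m m' q' => .inr (.inr (q, m, m', q'))
  refine Finite.of_injective f ?_
  rintro (_ | _ | _) (_ | _ | _) h <;> simp_all [f]

/-- The local game simulating the moves described by `R`; stacks are written from top to bottom. -/
inductive MoveStep (η : List A → M) (lm : A → M → M) (rm : M → A → M)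
    (R : M → M → Q → M → Q → Prop) : List A × MoveState Q M → List A × MoveState Q M → Prop
  | start (z q) : MoveStep η lm rm R (z, .main q) (z, .pop q (η []))
  | pop (a z q m) : MoveStep η lm rm R (a :: z, .pop q m) (z, .pop q (lm a m))
  | turn (z q m m' q') : R (η z.reverse) m q m' q' →
      MoveStep η lm rm R (z, .pop q m) (z, .push q (η []) m' q')
  | push (a z q m m' q') :
      MoveStep η lm rm R (z, .push q m m' q') (a :: z, .push q (rm m a) m' q')
  | finish (z q m q') : MoveStep η lm rm R (z, .push q m m q') (z, .main q')

variable {η : List A → M} {lm : A → M → M} {rm : M → A → M} {R : M → M → Q → M → Q → Prop}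

theorem isLocal_moveStep : IsLocal (MoveStep η lm rm R) := by
  intro v w h
  cases h <;> simp

/-- The finite information about a stack on which the local moves depend. -/
def stackType (η : List A → M) (z : List A) : Option A × M := (z.head?, η z.reverse)

theorem MoveStep.stay {z z' : List A} {s s' : MoveState Q M}
    (hz : stackType η z = stackType η z') (h : MoveStep η lm rm R (z, s) (z, s')) :
    MoveStep η lm rm R (z', s) (z', s') := by
  have hη : η z.reverse = η z'.reverse := congrArg Prod.snd hz
  cases h with
  | start => exact .start _ _
  | turn _ _ _ _ _ h => exact .turn _ _ _ _ _ (hη ▸ h)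
  | finish => exact .finish _ _ _ _

theorem MoveStep.pushes {a : A} {z z' : List A} {s s' : MoveState Q M}
    (h : MoveStep η lm rm R (z, s) (a :: z, s')) :
    MoveStep η lm rm R (z', s) (a :: z', s') := by
  cases h
  exact .push _ _ _ _ _ _

theorem MoveStep.pops {a b : A} {z z' : List A} {s s' : MoveState Q M}
    (hz : stackType η (a :: z) = stackType η (b :: z'))
    (h : MoveStep η lm rm R (a :: z, s) (z, s')) :
    MoveStep η lm rm R (b :: z', s) (z', s') := by
  obtain rfl : a = b := by simpa [stackType] using congrArg Prod.fst hz
  cases h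
  exact .pop _ _ _ _

end Moves

section Resolution

variable {A Q M : Type} {η : List A → M} {lm : A → M → M} {rm : M → A → M}
  {R : M → M → Q → M → Q → Prop} {own : Q → Prop} {col : MoveState Q M → ℕ} {bad : ℕ → Prop}
  (σ : LocalStrategy (MoveStep η lm rm R) (fun s => own s.source) col bad (stackType η))

namespace LocalStrategy

open MoveState

/-- A step of the strategy that is internal to the simulation of a single move. -/
def Quiet (v w : List A × MoveState Q M) : Prop := ¬ v.2.IsMain ∧ σ.Step v w

/-- A simulated move. -/
def Round (v w : List A × Q) : Prop :=
  ∃ x, σ.Step (v.1, .main v.2) x ∧ Relation.ReflTransGen σ.Quiet x (w.1, .main w.2)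

variable {σ}

theorem mem_of_quiet {v w : List A × MoveState Q M} (h : Relation.ReflTransGen σ.Quiet v w)
    (hv : v.2 ∈ σ.K (σ.h v.1)) : w.2 ∈ σ.K (σ.h w.1) := by
  induction h with
  | refl => exact hv
  | tail _ h _ => exact σ.step_mem _ _ h.2

theorem Round.mem {v w : List A × Q} (h : σ.Round v w) : .main w.2 ∈ σ.K (σ.h w.1) := by
  obtain ⟨x, hx, hq⟩ := h
  exact mem_of_quiet hq (σ.step_mem _ _ hx)

theorem exists_push {b : ℕ} (hb : bad b) (hcol : ∀ s, own s.source → ¬ s.IsMain → col s = b)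
    {q : Q} (hq : own q) (m' : M) (q' : Q) (z₀ : List A) (m : M)
    (hK : .push q m m' q' ∈ σ.K (σ.h z₀)) :
    ∃ v : List A, v.foldl rm m = m' ∧ ∀ z, σ.h z = σ.h z₀ →
      Relation.ReflTransGen σ.Quiet (z, .push q m m' q') (v.reverse ++ z, .main q') := by
  generalize ho : σ.ρ b (σ.h z₀) (.push q m m' q') = o
  induction o using WellFoundedLT.induction generalizing z₀ m with
  | _ o ih =>
    rcases σ.own_step _ _ hK hq with ⟨s', h⟩ | ⟨a, s', hρ, h⟩ | ⟨s', h⟩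
    · have hE := σ.step_edge _ _ (h z₀ rfl)
      cases hE
      exact ⟨[], rfl, fun z hz => .single ⟨not_isMain_push _ _ _ _, h z hz⟩⟩
    · have hE := σ.step_edge _ _ (h z₀ rfl)
      cases hE
      have hcb : col (.push q m m' q') = b := hcol _ hq (not_isMain_push _ _ _ _)
      rw [hcb] at hρ
      have hlt := hρ hb
      rw [← σ.h_cons, ho] at hlt
      obtain ⟨v, hv, hp⟩ := ih _ hlt (a :: z₀) (rm m a) (σ.step_mem _ _ (h z₀ rfl)) rfl
      refine ⟨a :: v, hv, fun z hz => .head ⟨not_isMain_push _ _ _ _, h z hz⟩ ?_⟩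
      simpa using hp (a :: z) (by rw [σ.h_cons, σ.h_cons, hz])
    · obtain ⟨a, z', rfl, h⟩ := h z₀ rfl
      have hE := σ.step_edge _ _ h
      cases hE

theorem foldl_eq (hrm : ∀ a u, η (u ++ [a]) = rm (η u) a) (u v : List A) :
    v.foldl rm (η u) = η (u ++ v) := by
  induction v generalizing u with
  | nil => simp
  | cons a v ih => simp [← hrm, ih]

variable (σ) in
/-- The function `D` prescribes legal moves of the simulated game that agree with the strategy: it
decides whether to pop a further letter or which word to push. -/
def IsDecision (D : σ.T → Q → M → Option (List A × Q)) : Prop :=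
  ∀ z q m, own q →
    (∀ v q', D (σ.h z) q m = some (v, q') → R (η z.reverse) m q (η v) q' ∧
      (.pop q m ∈ σ.K (σ.h z) →
        Relation.ReflTransGen σ.Quiet (z, .pop q m) (v.reverse ++ z, .main q'))) ∧
    (D (σ.h z) q m = none →
      (.pop q m ∈ σ.K (σ.h z) → ∃ a z', z = a :: z' ∧
        σ.Step (z, .pop q m) (z', .pop q (lm a m))) ∧
      (.pop q m ∉ σ.K (σ.h z) → ¬ ∃ v q', R (η z.reverse) m q (η v) q'))

theorem exists_decision (hrm : ∀ a u, η (u ++ [a]) = rm (η u) a) {b : ℕ} (hb : bad b)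
    (hcol : ∀ s, own s.source → ¬ s.IsMain → col s = b) :
    ∃ D, σ.IsDecision D := by
  suffices H : ∀ t q m, ∃ d : Option (List A × Q), ∀ z, σ.h z = t → own q →
      (∀ v q', d = some (v, q') → R (η z.reverse) m q (η v) q' ∧
        (.pop q m ∈ σ.K t →
          Relation.ReflTransGen σ.Quiet (z, .pop q m) (v.reverse ++ z, .main q'))) ∧
      (d = none →
        (.pop q m ∈ σ.K t → ∃ a z', z = a :: z' ∧ σ.Step (z, .pop q m) (z', .pop q (lm a m))) ∧
        (.pop q m ∉ σ.K t → ¬ ∃ v q', R (η z.reverse) m q (η v) q')) by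
    choose D hD using H
    exact ⟨D, fun z q m hq => hD _ q m z rfl hq⟩
  intro t q m
  by_cases hq : own q
  swap
  · exact ⟨none, fun _ _ h => (hq h).elim⟩
  by_cases ht : ∃ z, σ.h z = t
  swap
  · exact ⟨none, fun z hz => (ht ⟨z, hz⟩).elim⟩
  obtain ⟨z₀, rfl⟩ := ht
  have hη : ∀ z, σ.h z = σ.h z₀ → η z.reverse = η z₀.reverse :=
    fun z hz => congrArg Prod.snd (σ.ext_eq _ _ hz)
  by_cases hK : .pop q m ∈ σ.K (σ.h z₀)
  · rcases σ.own_step _ _ hK hq with ⟨s', h⟩ | ⟨a, s', -, h⟩ | ⟨s', h⟩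
    · have hE := σ.step_edge _ _ (h z₀ rfl)
      cases hE with
      | turn _ _ _ m' q' hR =>
        obtain ⟨v, hv, hp⟩ := exists_push hb hcol hq m' q' z₀ (η []) (σ.step_mem _ _ (h z₀ rfl))
        rw [foldl_eq hrm, List.nil_append] at hv
        subst hv
        refine ⟨some (v, q'), fun z hz _ => ⟨?_, by simp⟩⟩
        rintro v q' ⟨⟩
        rw [hη z hz]
        exact ⟨hR, fun _ => .head ⟨not_isMain_pop _ _, h z hz⟩ (hp z hz)⟩
    · have hE := σ.step_edge _ _ (h z₀ rfl)
      cases hE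
    · refine ⟨none, fun z hz _ => ⟨by simp, fun _ => ⟨fun _ => ?_, fun h => (h hK).elim⟩⟩⟩
      obtain ⟨a, z', rfl, h⟩ := h z hz
      have hE := σ.step_edge _ _ h
      cases hE
      exact ⟨a, z', rfl, h⟩
  · by_cases hex : ∃ v q', R (η z₀.reverse) m q (η v) q'
    · obtain ⟨v, q', hR⟩ := hex
      refine ⟨some (v, q'), fun z hz _ => ⟨?_, by simp⟩⟩
      rintro v q' ⟨⟩
      rw [hη z hz]
      exact ⟨hR, fun h => (hK h).elim⟩
    · refine ⟨none, fun z hz _ => ⟨by simp, fun _ => ⟨fun h => (hK h).elim, fun _ => ?_⟩⟩⟩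
      rwa [hη z hz]

theorem quiet_of_opp {z : List A} {s : MoveState Q M} {w : List A × MoveState Q M}
    (hK : s ∈ σ.K (σ.h z)) (hs : ¬ own s.source) (hm : ¬ s.IsMain)
    (h : MoveStep η lm rm R (z, s) w) : σ.Quiet (z, s) w := ⟨hm, σ.opp_step _ _ _ hK hs h⟩

theorem quiet_pop_of_opp (hlm : ∀ a u, η (a :: u) = lm a (η u)) {q : Q} (hq : ¬ own q)
    (z₁ z₂ u : List A) (hK : .pop q (η u) ∈ σ.K (σ.h (z₁ ++ z₂))) :
    Relation.ReflTransGen σ.Quiet (z₁ ++ z₂, .pop q (η u))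
      (z₂, .pop q (η (z₁.reverse ++ u))) := by
  induction z₁ generalizing u with
  | nil => exact .refl
  | cons a z₁ ih =>
    have hstep := quiet_of_opp hK hq (not_isMain_pop _ _) (.pop a (z₁ ++ z₂) q (η u))
    rw [← hlm] at hstep
    refine .head hstep ?_
    simpa using ih (a :: u) (σ.step_mem _ _ hstep.2)

theorem quiet_push_of_opp (hrm : ∀ a u, η (u ++ [a]) = rm (η u) a) {q : Q} (hq : ¬ own q)
    (q' : Q) (v z u : List A) (hK : .push q (η u) (η (u ++ v)) q' ∈ σ.K (σ.h z)) :
    Relation.ReflTransGen σ.Quiet (z, .push q (η u) (η (u ++ v)) q')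
      (v.reverse ++ z, .main q') := by
  induction v generalizing u z with
  | nil =>
    rw [List.append_nil] at hK ⊢
    exact .single (quiet_of_opp hK hq (not_isMain_push _ _ _ _) (.finish _ _ _ _))
  | cons a v ih =>
    have hstep := quiet_of_opp hK hq (not_isMain_push _ _ _ _)
      (.push a z q (η u) (η (u ++ a :: v)) q')
    rw [← hrm] at hstep
    refine .head hstep ?_
    have := ih (a :: z) (u ++ [a])
    simp only [List.append_assoc, List.cons_append, List.nil_append, List.reverse_cons] at this ⊢
    exact this (σ.step_mem _ _ hstep.2)

/-- Every move of the opponent is simulated. -/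
theorem round_of_opp (hlm : ∀ a u, η (a :: u) = lm a (η u))
    (hrm : ∀ a u, η (u ++ [a]) = rm (η u) a) {q : Q} (hq : ¬ own q) {z₁ z₂ v : List A} {q' : Q}
    (hK : .main q ∈ σ.K (σ.h (z₁ ++ z₂)))
    (hR : R (η z₂.reverse) (η z₁.reverse) q (η v) q') :
    σ.Round (z₁ ++ z₂, q) (v.reverse ++ z₂, q') := by
  have h₁ := σ.opp_step _ _ _ hK hq (.start (z₁ ++ z₂) q)
  have h₂ := quiet_pop_of_opp hlm hq z₁ z₂ [] (σ.step_mem _ _ h₁)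
  rw [List.append_nil] at h₂
  have hK₂ := mem_of_quiet h₂ (σ.step_mem _ _ h₁)
  have h₃ := quiet_of_opp hK₂ hq (not_isMain_pop _ _) (.turn _ _ _ _ _ hR)
  exact ⟨_, h₁, h₂.trans (.head h₃ (quiet_push_of_opp hrm hq q' v z₂ []
    (σ.step_mem _ _ h₃.2)))⟩

end LocalStrategy

end Resolution

section Walk

variable {A Q M T : Type} (h : List A → T) (lm : A → M → M)
  (D : T → Q → M → Option (List A × Q))

/-- Pop letters until the decision function `D` prescribes a word to push. -/
def walk (q : Q) : List A → M → List A × Q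
  | [], m => (D (h []) q m).elim ([], q) fun d => (d.1.reverse, d.2)
  | a :: z, m => (D (h (a :: z)) q m).elim (walk q z (lm a m)) fun d =>
      (d.1.reverse ++ a :: z, d.2)

/-- The decision function `D` prescribes to pop `z₁` from the stack `z₁ ++ z₂`. -/
def PopsThrough (q : Q) (z₂ : List A) : List A → M → Prop
  | [], _ => True
  | a :: z₁, m => D (h (a :: (z₁ ++ z₂))) q m = none ∧ PopsThrough q z₂ z₁ (lm a m)

variable {h lm D}

theorem walk_of_eq_some {q : Q} {z : List A} {m : M} {v : List A} {q' : Q}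
    (hD : D (h z) q m = some (v, q')) : walk h lm D q z m = (v.reverse ++ z, q') := by
  cases z <;> simp [walk, hD]

theorem walk_append {η : List A → M} (hlm : ∀ a u, η (a :: u) = lm a (η u)) {q : Q}
    {z₁ z₂ u : List A} (hp : PopsThrough h lm D q z₂ z₁ (η u)) :
    walk h lm D q (z₁ ++ z₂) (η u) = walk h lm D q z₂ (η (z₁.reverse ++ u)) := by
  induction z₁ generalizing u with
  | nil => rfl
  | cons a z₁ ih =>
    obtain ⟨hD, hp⟩ := hp
    rw [← hlm] at hp
    simp [walk, hD, ← hlm, ih hp]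

/-- The automaton checking, while it reads a word to be popped from its end on the stack, whether
`D` prescribes to pop it. -/
def popStep (η₀ : A → T → T) (lm : A → M → M) (rm : M → A → M)
    (D : T → Q → M → Option (List A × Q)) (q : Q) (s : T × M × Set M) (a : A) : T × M × Set M :=
  (η₀ a s.1, rm s.2.1 a, {m | D (η₀ a s.1) q m = none ∧ lm a m ∈ s.2.2})

theorem foldl_popStep {η : List A → M} {rm : M → A → M} {δ : A → T → T}
    (hrm : ∀ a u, η (u ++ [a]) = rm (η u) a) (hδ : ∀ a z, h (a :: z) = δ a (h z)) (q : Q)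
    (z u : List A) : u.foldl (popStep δ lm rm D q) (h z, η [], Set.univ) =
      (h (u.reverse ++ z), η u, {m | PopsThrough h lm D q z u.reverse m}) := by
  induction u using List.reverseRecOn with
  | nil => simp [PopsThrough]
  | append_singleton u a ih =>
    rw [List.foldl_append, ih]
    simp [popStep, hδ, hrm, PopsThrough]

theorem foldl_reverse_automaton {δ : A → T → T} (hδ : ∀ a z, h (a :: z) = δ a (h z))
    (w : List A) : w.foldl (fun t a => δ a t) (h []) = h w.reverse := by
  induction w using List.reverseRecOn with
  | nil => rfl
  | append_singleton w a ih => simp [ih, hδ]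

end Walk

section WalkLanguages

variable {A Q : Type}

/-- The automaton on encodings of configurations that reads the stack with `δ`, and then accepts
if the state and the control state are in `F`. -/
def encodeStep {S : Type} (δ : S → A → S) (F : Set (S × Q)) : S ⊕ Prop → A ⊕ Q → S ⊕ Prop
  | .inl s, .inl a => .inl (δ s a)
  | .inl s, .inr q => .inr ((s, q) ∈ F)
  | .inr _, _ => .inr False

theorem foldl_encodeStep_map_inl {S : Type} (δ : S → A → S) (F : Set (S × Q)) (s : S)
    (u : List A) : (u.map Sum.inl).foldl (encodeStep δ F) (.inl s) = .inl (u.foldl δ s) := by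
  induction u generalizing s with
  | nil => rfl
  | cons a u ih => exact ih _

theorem foldl_encodeStep_inr {S : Type} (δ : S → A → S) (F : Set (S × Q)) (p : Prop)
    (u : List (A ⊕ Q)) : u.foldl (encodeStep δ F) (.inr p) = .inr (p ∧ u = []) := by
  induction u generalizing p with
  | nil => simp
  | cons a u ih =>
    change u.foldl (encodeStep δ F) (Sum.inr False) = _
    simp [ih]

theorem foldl_encodeStep_encode {S : Type} (δ : S → A → S) (F : Set (S × Q)) (s : S)
    (u : List A) (q : Q) (w : List (A ⊕ Q)) :
    (encode (u, q) ++ w).foldl (encodeStep δ F) (.inl s) =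
      .inr ((u.foldl δ s, q) ∈ F ∧ w = []) := by
  rw [List.foldl_append, encode, List.foldl_append, foldl_encodeStep_map_inl,
    ← foldl_encodeStep_inr]
  rfl

/-- A word over the alphabet of encodings is a stack content, or starts with an encoding. -/
theorem eq_map_inl_or_eq_encode_append (w : List (A ⊕ Q)) :
    (∃ u : List A, w = u.map Sum.inl) ∨ ∃ u q w', w = encode (u, q) ++ w' := by
  induction w with
  | nil => exact Or.inl ⟨[], rfl⟩
  | cons b w ih =>
    rcases b with a | q
    · rcases ih with ⟨u, rfl⟩ | ⟨u, q, w', rfl⟩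
      · exact Or.inl ⟨a :: u, rfl⟩
      · exact Or.inr ⟨a :: u, q, w', rfl⟩
    · exact Or.inr ⟨[], q, w, rfl⟩

theorem encode_append_ne_map_inl (v : List A × Q) (w : List (A ⊕ Q)) (u : List A) :
    encode v ++ w ≠ u.map Sum.inl := by
  intro h
  have : Sum.inr v.2 ∈ u.map (Sum.inl : A → A ⊕ Q) := h ▸ by simp [encode]
  simp at this

theorem regularLang_map_inl {S : Type} [Finite S] (δ : S → A → S) (s : S) (F : Set S) :
    RegularLang {w : List (A ⊕ Q) | ∃ u : List A, w = u.map Sum.inl ∧ u.foldl δ s ∈ F} := by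
  convert regularLang_of_finite_states (Sum.inl s) (encodeStep (Q := Q) δ ∅) (Sum.inl '' F) using 1
  ext w
  rcases eq_map_inl_or_eq_encode_append w with ⟨u, rfl⟩ | ⟨u, q', w, rfl⟩
  · have := List.map_injective_iff.2 (Sum.inl_injective (α := A) (β := Q))
    simp [foldl_encodeStep_map_inl, this.eq_iff]
  · rw [Set.mem_ofPred_eq, Set.mem_ofPred_eq, foldl_encodeStep_encode]
    simp [encode_append_ne_map_inl]

theorem regularLang_encode {S : Type} [Finite S] (δ : S → A → S) (s : S) (F : Set (S × Q)) :
    RegularLang {w : List (A ⊕ Q) | ∃ v : List A × Q, w = encode v ∧ (v.1.foldl δ s, v.2) ∈ F} := by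
  convert regularLang_of_finite_states (Sum.inl s) (encodeStep δ F) {Sum.inr True} using 1
  ext w
  rcases eq_map_inl_or_eq_encode_append w with ⟨u, rfl⟩ | ⟨u, q, w, rfl⟩
  · have : ∀ v : List A × Q, u.map Sum.inl ≠ encode v := fun v h =>
      encode_append_ne_map_inl v [] u (by simp [h])
    simp [foldl_encodeStep_map_inl, this]
  · rw [Set.mem_ofPred_eq, Set.mem_ofPred_eq, foldl_encodeStep_encode]
    simp only [Set.mem_singleton_iff, Sum.inr.injEq, eq_iff_iff, iff_true]
    constructor
    · rintro ⟨⟨x, q'⟩, h, hF⟩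
      rcases encode_eq_append.1 h.symm with ⟨rfl, h'⟩ | ⟨x₁, x₂, rfl, h', rfl⟩
      · obtain ⟨rfl, rfl⟩ : u = x ∧ q = q' := by simpa using encode_injective h'
        exact ⟨hF, rfl⟩
      · exact (encode_append_ne_map_inl (u, q) [] x₁ (by simp [h'])).elim
    · rintro ⟨hF, rfl⟩
      exact ⟨(u, q), by simp, hF⟩

theorem regularLang_singleton {B : Type} (w : List B) : RegularLang {w} := by
  classical
  induction w with
  | nil => exact regularLang_singleton_nil
  | cons b w ih =>
    obtain ⟨n, s₀, δ, F, h⟩ := ih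
    convert regularLang_of_finite_states (none : Option (Option (Fin n)))
      (fun s a => s.elim (if a = b then some (some s₀) else some none)
        fun s => some (s.map fun s => δ s a))
      {s | ∃ f ∈ F, s = some (some f)} using 1
    have hrun : ∀ (u : List B) (s : Option (Fin n)),
        u.foldl (fun s a => s.elim (if a = b then some (some s₀) else some none)
          fun s => some (s.map fun s => δ s a)) (some s) = some (s.map fun s => u.foldl δ s) := by
      intro u
      induction u with
      | nil => intro s; cases s <;> rfl
      | cons a u ih => intro s; cases s <;> simp [ih]
    ext u
    rcases u with _ | ⟨a, u⟩
    · simp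
    · by_cases hab : a = b
      · simp [hab, hrun, ← h]
      · simp [hab, hrun]

/-- A finite union of products of regular languages over a common prefix. -/
theorem prefixRecognizable_of_finite {B I : Type} [Finite I] {R : List B → List B → Prop}
    (U V W : I → Set (List B)) (hU : ∀ i, RegularLang (U i)) (hV : ∀ i, RegularLang (V i))
    (hW : ∀ i, RegularLang (W i))
    (hR : ∀ w₁ w₂, R w₁ w₂ ↔ ∃ i, ∃ w ∈ W i, ∃ u ∈ U i, ∃ v ∈ V i, w₁ = w ++ u ∧ w₂ = w ++ v) :
    PrefixRecognizable R := by
  obtain ⟨n, ⟨e⟩⟩ := Finite.exists_equiv_fin I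
  refine ⟨n, U ∘ e.symm, V ∘ e.symm, W ∘ e.symm, fun i => ⟨hU _, hV _, hW _⟩, fun w₁ w₂ => ?_⟩
  rw [hR]
  exact ⟨fun ⟨i, hi⟩ => ⟨e i, by simpa using hi⟩, fun ⟨j, hj⟩ => ⟨e.symm j, hj⟩⟩

theorem regularLang_empty {B : Type} : RegularLang (∅ : Set (List B)) :=
  ⟨1, 0, fun _ _ => 0, ∅, by simp⟩

/-- The moves along a walk form a prefix-recognizable relation. -/
theorem prefixRecognizable_walk {M T : Type} [Finite Q] [Finite M] [Finite T] {h : List A → T}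
    {δ : A → T → T} (hδ : ∀ a z, h (a :: z) = δ a (h z)) {η : List A → M} {lm : A → M → M}
    {rm : M → A → M} (hlm : ∀ a u, η (a :: u) = lm a (η u))
    (hrm : ∀ a u, η (u ++ [a]) = rm (η u) a) (D : T → Q → M → Option (List A × Q))
    (own : Q → Prop)
    (hex : ∀ q, own q → ∀ z, ∃ z₁ z₂ d, z = z₁ ++ z₂ ∧ PopsThrough h lm D q z₂ z₁ (η []) ∧
      D (h z₂) q (η z₁.reverse) = some d) :
    PrefixRecognizable fun w₁ w₂ => ∃ u : List A × Q, own u.2 ∧ w₁ = encode u ∧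
      w₂ = encode ((walk h lm D u.2 u.1.reverse (η [])).1.reverse,
        (walk h lm D u.2 u.1.reverse (η [])).2) := by
  have hwalk : ∀ q z₁ z₂ v q', PopsThrough h lm D q z₂ z₁ (η []) →
      D (h z₂) q (η z₁.reverse) = some (v, q') →
      walk h lm D q (z₁ ++ z₂) (η []) = (v.reverse ++ z₂, q') := by
    intro q z₁ z₂ v q' hp hD
    rw [walk_append hlm hp, List.append_nil, walk_of_eq_some hD]
  refine prefixRecognizable_of_finite (I := T × Q × M)
    (fun i => {w | ∃ v : List A × Q, w = encode v ∧
      (v.1.foldl (popStep δ lm rm D i.2.1) (i.1, η [], Set.univ), v.2) ∈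
        {x : (T × M × Set M) × Q | x.2 = i.2.1 ∧ own x.2 ∧ x.1.2.1 = i.2.2 ∧ η [] ∈ x.1.2.2}})
    (fun i => {w | ∃ d, D i.1 i.2.1 i.2.2 = some d ∧ w = encode d})
    (fun i => {w | ∃ u : List A, w = u.map Sum.inl ∧
      u.foldl (fun t a => δ a t) (h []) ∈ ({i.1} : Set T)})
    (fun i => regularLang_encode _ _ _) (fun i => ?_) (fun i => regularLang_map_inl _ _ _)
    (fun w₁ w₂ => ?_)
  · rcases hD : D i.1 i.2.1 i.2.2 with _ | d
    · convert regularLang_empty using 1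
      ext w
      simp
    · convert regularLang_singleton (encode d) using 1
      ext w
      simp
  · constructor
    · rintro ⟨⟨x, q⟩, hq, rfl, rfl⟩
      obtain ⟨z₁, z₂, ⟨v, q'⟩, hx, hp, hD⟩ := hex q hq x.reverse
      have hx' := congrArg List.reverse hx
      rw [List.reverse_reverse, List.reverse_append] at hx'
      dsimp only
      rw [hx, hwalk _ _ _ _ _ hp hD, hx']
      refine ⟨(h z₂, q, η z₁.reverse), _, ⟨z₂.reverse, rfl, ?_⟩, _,
        ⟨(z₁.reverse, q), rfl, ?_⟩, _, ⟨_, hD, rfl⟩, ?_, ?_⟩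
      · rw [foldl_reverse_automaton hδ, List.reverse_reverse, Set.mem_singleton_iff]
      · rw [foldl_popStep hrm hδ]
        exact ⟨rfl, hq, rfl, by simpa using hp⟩
      · simp [encode]
      · simp [encode]
    · rintro ⟨⟨t, q, m⟩, _, ⟨w, rfl, ht⟩, _, ⟨⟨u, q₁⟩, rfl, hu⟩, _, ⟨⟨v, q'⟩, hD, rfl⟩, rfl, rfl⟩
      rw [foldl_reverse_automaton hδ, Set.mem_singleton_iff] at ht
      subst ht
      rw [foldl_popStep hrm hδ] at hu
      obtain ⟨hq₁, hq, hm, hp⟩ := hu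
      dsimp only at hD hq₁ hq hm hp
      subst hq₁ hm
      refine ⟨(w ++ u, q₁), hq, by simp [encode], ?_⟩
      have := hwalk q₁ u.reverse w.reverse v q' hp (by simpa using hD)
      simp [this, encode]

end WalkLanguages

section WalkResolution

variable {A Q M : Type} {η : List A → M} {lm : A → M → M} {rm : M → A → M}
  {R : M → M → Q → M → Q → Prop} {own : Q → Prop} {col : MoveState Q M → ℕ} {bad : ℕ → Prop}
  {σ : LocalStrategy (MoveStep η lm rm R) (fun s => own s.source) col bad (stackType η)}
  {D : σ.T → Q → M → Option (List A × Q)}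

namespace LocalStrategy

open MoveState

/-- If the strategy is followed, or else if there is a legal move, then the walk along `D` ends with
a prescribed word. -/
theorem IsDecision.exists_popsThrough (hD : σ.IsDecision D)
    (hlm : ∀ a u, η (a :: u) = lm a (η u)) {q : Q} (hq : own q) (z u : List A)
    (hz : .pop q (η u) ∈ σ.K (σ.h z) ∨ ∃ z₁ z₂ v q', z = z₁ ++ z₂ ∧
      R (η z₂.reverse) (η (z₁.reverse ++ u)) q (η v) q') :
    ∃ z₁ z₂ d, z = z₁ ++ z₂ ∧ PopsThrough σ.h lm D q z₂ z₁ (η u) ∧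
      D (σ.h z₂) q (η (z₁.reverse ++ u)) = some d := by
  induction z generalizing u with
  | nil =>
    rcases hd : D (σ.h []) q (η u) with _ | d
    · obtain ⟨h₁, h₂⟩ := (hD [] q (η u) hq).2 hd
      by_cases hK : .pop q (η u) ∈ σ.K (σ.h [])
      · obtain ⟨a, z', h, -⟩ := h₁ hK
        cases h
      · obtain ⟨z₁, z₂, v, q', h, hR⟩ := hz.resolve_left hK
        obtain ⟨rfl, rfl⟩ := List.nil_eq_append_iff.1 h
        exact (h₂ hK ⟨v, q', hR⟩).elim
    · exact ⟨[], [], d, rfl, trivial, hd⟩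
  | cons a z ih =>
    rcases hd : D (σ.h (a :: z)) q (η u) with _ | d
    · obtain ⟨h₁, h₂⟩ := (hD _ q (η u) hq).2 hd
      have hz' : .pop q (η (a :: u)) ∈ σ.K (σ.h z) ∨ ∃ z₁ z₂ v q', z = z₁ ++ z₂ ∧
          R (η z₂.reverse) (η (z₁.reverse ++ a :: u)) q (η v) q' := by
        by_cases hK : .pop q (η u) ∈ σ.K (σ.h (a :: z))
        · obtain ⟨a', z', h, hs⟩ := h₁ hK
          cases h
          rw [← hlm] at hs
          exact Or.inl (σ.step_mem _ _ hs)
        · obtain ⟨z₁, z₂, v, q', h, hR⟩ := hz.resolve_left hK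
          rcases z₁ with _ | ⟨a', z₁⟩
          · cases h
            exact (h₂ hK ⟨v, q', hR⟩).elim
          · cases h
            exact Or.inr ⟨z₁, z₂, v, q', rfl, by simpa using hR⟩
      obtain ⟨z₁, z₂, d, rfl, hp, hd'⟩ := ih (a :: u) hz'
      refine ⟨a :: z₁, z₂, d, rfl, ⟨hd, ?_⟩, by simpa using hd'⟩
      rwa [← hlm]
    · exact ⟨[], a :: z, d, rfl, trivial, hd⟩

/-- The strategy follows the walk along `D`. -/
theorem IsDecision.quiet_walk (hD : σ.IsDecision D) {q : Q} (hq : own q) (z : List A) (m : M)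
    (hK : .pop q m ∈ σ.K (σ.h z)) :
    Relation.ReflTransGen σ.Quiet (z, .pop q m)
      ((walk σ.h lm D q z m).1, .main (walk σ.h lm D q z m).2) := by
  induction z generalizing m with
  | nil =>
    rcases hd : D (σ.h []) q m with _ | ⟨v, q'⟩
    · obtain ⟨a, z', h, -⟩ := ((hD _ q m hq).2 hd).1 hK
      cases h
    · rw [walk_of_eq_some hd]
      exact ((hD _ q m hq).1 v q' hd).2 hK
  | cons a z ih =>
    rcases hd : D (σ.h (a :: z)) q m with _ | ⟨v, q'⟩
    · obtain ⟨a', z', h, hs⟩ := ((hD _ q m hq).2 hd).1 hK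
      cases h
      have hquiet : σ.Quiet (a :: z, .pop q m) (z, .pop q (lm a m)) := ⟨not_isMain_pop _ _, hs⟩
      simpa [walk, hd] using Relation.ReflTransGen.head hquiet (ih _ (σ.step_mem _ _ hs))
    · rw [walk_of_eq_some hd]
      exact ((hD _ q m hq).1 v q' hd).2 hK

theorem IsDecision.round_walk (hD : σ.IsDecision D) {q : Q} (hq : own q) (z : List A)
    (hK : .main q ∈ σ.K (σ.h z)) : σ.Round (z, q) (walk σ.h lm D q z (η [])) := by
  rcases σ.own_step _ _ hK hq with ⟨s', h⟩ | ⟨a, s', -, h⟩ | ⟨s', h⟩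
  · have hs := h z rfl
    have hE := σ.step_edge _ _ hs
    cases hE
    exact ⟨_, hs, hD.quiet_walk hq z _ (σ.step_mem _ _ hs)⟩
  · have hE := σ.step_edge _ _ (h z rfl)
    cases hE
  · obtain ⟨a, z', rfl, h⟩ := h z rfl
    have hE := σ.step_edge _ _ h
    cases hE

end LocalStrategy

end WalkResolution

section Concatenation

theorem Relation.ReflTransGen.exists_path {V : Type} {r : V → V → Prop} {x y : V}
    (h : Relation.ReflTransGen r x y) :
    ∃ (n : ℕ) (c : ℕ → V), c 0 = x ∧ c n = y ∧ ∀ i < n, r (c i) (c (i + 1)) := by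
  induction h using Relation.ReflTransGen.head_induction_on with
  | refl => exact ⟨0, fun _ => y, rfl, rfl, by simp⟩
  | @head x x' hx _ ih =>
    obtain ⟨n, c, rfl, hn, hc⟩ := ih
    refine ⟨n + 1, fun i => i.casesOn x c, rfl, hn, fun i hi => ?_⟩
    cases i with
    | zero => exact hx
    | succ i => exact hc i (by omega)

/-- Concatenation of infinitely many finite paths. The function `f` counts the paths completed. -/
theorem exists_concat {V : Type} {step : V → V → Prop} {main : V → Prop} {p : ℕ → V}
    (hp : ∀ n, ∃ x, step (p n) x ∧
      Relation.ReflTransGen (fun v w => ¬ main v ∧ step v w) x (p (n + 1))) :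
    ∃ (π : ℕ → V) (f : ℕ → ℕ), (∀ n, step (π n) (π (n + 1))) ∧ Monotone f ∧
      (∀ n, main (π n) → π n = p (f n)) ∧ ∀ k, ∃ n, f n = k ∧ π n = p k := by
  have hseg : ∀ n, ∃ (l : ℕ) (c : ℕ → V), c 0 = p n ∧ c (l + 1) = p (n + 1) ∧
      (∀ i ≤ l, step (c i) (c (i + 1))) ∧ ∀ i < l, ¬ main (c (i + 1)) := by
    intro n
    obtain ⟨x, hx, h⟩ := hp n
    obtain ⟨l, c, rfl, hl, hc⟩ := h.exists_path
    refine ⟨l, fun i => i.casesOn (p n) c, rfl, hl, fun i hi => ?_, fun i hi => (hc i hi).1⟩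
    cases i with
    | zero => exact hx
    | succ i => exact (hc i hi).2
  choose l c hc₀ hcl hstep hmain using hseg
  let next : ℕ × ℕ → ℕ × ℕ := fun s => if s.2 < l s.1 then (s.1, s.2 + 1) else (s.1 + 1, 0)
  let s : ℕ → ℕ × ℕ := fun n => next^[n] (0, 0)
  have hs : ∀ n, s (n + 1) = next (s n) := fun n => Function.iterate_succ_apply' _ _ _
  have hle : ∀ n, (s n).2 ≤ l (s n).1 := by
    intro n
    induction n with
    | zero => exact Nat.zero_le _
    | succ n ih =>
      rw [hs]
      by_cases h : (s n).2 < l (s n).1 <;> simp only [next, h, if_true, if_false]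
      · exact h
      · exact Nat.zero_le _
  have hreach : ∀ k, ∃ n, s n = (k, 0) := by
    intro k
    induction k with
    | zero => exact ⟨0, rfl⟩
    | succ k ih =>
      obtain ⟨n, hn⟩ := ih
      have : ∀ i ≤ l k, s (n + i) = (k, i) := by
        intro i hi
        induction i with
        | zero => exact hn
        | succ i ih =>
          rw [← add_assoc, hs, ih (by omega)]
          simp [next, Nat.lt_of_succ_le hi]
      exact ⟨n + l k + 1, by rw [hs, this _ le_rfl]; simp [next]⟩
  refine ⟨fun n => c (s n).1 (s n).2, fun n => (s n).1, fun n => ?_,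
    monotone_nat_of_le_succ fun n => ?_, fun n hn => ?_, fun k => ?_⟩
  · by_cases h : (s n).2 < l (s n).1
    · simpa [hs, next, h] using hstep _ _ h.le
    · have hl : (s n).2 = l (s n).1 := le_antisymm (hle n) (not_lt.1 h)
      have := hstep (s n).1 _ le_rfl
      rw [hcl, ← hc₀, ← hl] at this
      simpa [hs, next, h] using this
  · by_cases h : (s n).2 < l (s n).1 <;> simp [hs, next, h]
  · rcases hi : (s n).2 with _ | i
    · simp only [hi, hc₀]
    · have := hle n
      rw [hi] at this
      simp only [hi] at hn
      exact (hmain _ _ this hn).elim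
  · obtain ⟨n, hn⟩ := hreach k
    exact ⟨n, by simp [hn], by simp [hn, hc₀]⟩

theorem exists_max_recurring {s : ℕ → ℕ} {N : ℕ} (hs : ∀ k, s k ≤ N) :
    ∃ m, (∀ n, ∃ k, n ≤ k ∧ s k = m) ∧ ∃ K, ∀ k, K ≤ k → s k ≤ m := by
  classical
  have hex : ∃ m, ∃ K, ∀ k, K ≤ k → s k ≤ m := ⟨N, 0, fun k _ => hs k⟩
  obtain ⟨K, hK⟩ := Nat.find_spec hex
  refine ⟨Nat.find hex, fun n => ?_, K, hK⟩
  by_contra! h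
  have hlt : ∀ k, max n K ≤ k → s k < Nat.find hex := fun k hk =>
    lt_of_le_of_ne (hK k (le_of_max_le_right hk)) (h k (le_of_max_le_left hk))
  have := hlt _ le_rfl
  exact Nat.find_min hex (m := Nat.find hex - 1) (by omega)
    ⟨max n K, fun k hk => Nat.le_sub_one_of_lt (hlt k hk)⟩

theorem maxInfEven_iff {s : ℕ → ℕ} {m K : ℕ} (hm : ∀ n, ∃ k, n ≤ k ∧ s k = m)
    (hK : ∀ k, K ≤ k → s k ≤ m) : MaxInfEven s ↔ Even m := by
  have hinf : {k | s k = m}.Infinite := by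
    refine Set.infinite_of_not_bddAbove fun ⟨b, hb⟩ => ?_
    obtain ⟨k, hk, h⟩ := hm (b + 1)
    have := hb h
    omega
  have hmax : ∀ m', {k | s k = m'}.Infinite → m' ≤ m := by
    intro m' h
    obtain ⟨k, hk, hlt⟩ := h.exists_gt K
    exact hk ▸ hK k hlt.le
  refine ⟨fun ⟨m', he, h, h'⟩ => ?_, fun h => ⟨m, h, hinf, hmax⟩⟩
  rwa [le_antisymm (h' m hinf) (hmax m' h)]

end Concatenation

section Plays

variable {V : Type}

theorem hist_succ (π : ℕ → V) (n : ℕ) : hist π (n + 1) = hist π n ++ [π (n + 1)] := by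
  rw [hist, List.ofFn_succ_last]
  rfl

theorem getLast?_hist (π : ℕ → V) (n : ℕ) : (hist π n).getLast? = some (π n) := by
  cases n with
  | zero => rfl
  | succ n => simp [hist_succ]

/-- The players do not both have a winning strategy. -/
theorem not_winningStrategyFrom_other {G : GameGraph V} {p : Player} {σ τ : List V → V} {u₀ : V}
    (hσ : WinningStrategyFrom G p σ u₀) (hτ : WinningStrategyFrom G p.other τ u₀) : False := by
  classical
  have hother : ∀ v, G.owner v = p.other ↔ G.owner v ≠ p := by
    intro v
    cases p <;> cases G.owner v <;> simp [Player.other]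
  let next : List V → V := fun l =>
    if G.owner (l.getLast?.getD u₀) = p then σ l else τ l
  let L : ℕ → List V := fun n => (fun l => l ++ [next l])^[n] [u₀]
  have hL : ∀ n, L (n + 1) = L n ++ [next (L n)] := fun n => Function.iterate_succ_apply' _ _ _
  let π : ℕ → V := fun n => (L n).getLast?.getD u₀
  have hπ : ∀ n, π (n + 1) = next (L n) := fun n => by simp [π, hL]
  have hist_eq : ∀ n, hist π n = L n := by
    intro n
    induction n with
    | zero => rfl
    | succ n ih => rw [hist_succ, ih, hL, hπ]
  have hlast : ∀ n, (L n).getLast? = some (π n) := fun n => by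
    rw [← hist_eq, getLast?_hist]
  have hnext₁ : ∀ n, G.owner (π n) = p → π (n + 1) = σ (L n) := fun n h => by
    rw [hπ]
    exact if_pos h
  have hnext₂ : ∀ n, G.owner (π n) ≠ p → π (n + 1) = τ (L n) := fun n h => by
    rw [hπ]
    exact if_neg h
  have hcons : ∀ n, ConsHist G p σ u₀ (L n) ∧ ConsHist G p.other τ u₀ (L n) ∧
      G.E (π n) (π (n + 1)) := by
    have hE : ∀ n, ConsHist G p σ u₀ (L n) → ConsHist G p.other τ u₀ (L n) →
        G.E (π n) (π (n + 1)) := by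
      intro n h₁ h₂
      by_cases h : G.owner (π n) = p
      · rw [hnext₁ n h]
        exact hσ.1 _ _ h₁ (hlast n) h
      · rw [hnext₂ n h]
        exact hτ.1 _ _ h₂ (hlast n) ((hother _).2 h)
    intro n
    induction n with
    | zero => exact ⟨.init, .init, hE 0 .init .init⟩
    | succ n ih =>
      obtain ⟨h₁, h₂, h₃⟩ := ih
      suffices ConsHist G p σ u₀ (L (n + 1)) ∧ ConsHist G p.other τ u₀ (L (n + 1)) from
        ⟨this.1, this.2, hE _ this.1 this.2⟩
      rw [hL, ← hπ]
      by_cases h : G.owner (π n) = p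
      · refine ⟨?_, .oppStep _ _ _ h₂ (hlast n) (fun h' => (hother _).1 h' h) h₃⟩
        rw [hnext₁ n h]
        exact .ownStep _ _ h₁ (hlast n) h
      · refine ⟨.oppStep _ _ _ h₁ (hlast n) h h₃, ?_⟩
        rw [hnext₂ n h]
        exact .ownStep _ _ h₂ (hlast n) ((hother _).2 h)
  have hplay : IsPlayFrom G u₀ π := ⟨rfl, fun n => (hcons n).2.2⟩
  have w₁ := hσ.2 π hplay fun n h => by rw [hist_eq]; exact hnext₁ n h
  have w₂ := hτ.2 π hplay fun n h => by rw [hist_eq]; exact hnext₂ n ((hother _).1 h)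
  cases p
  · exact w₁ w₂
  · exact w₂ w₁

end Plays

section Simulation

variable {A Q M : Type}

/-- The parities by which a player loses. -/
def Player.Loses (p : Player) (c : ℕ) : Prop :=
  match p with
  | .one => Even c
  | .two => ¬ Even c

/-- The color punishing a player for simulating a single move forever. -/
def Player.penalty : Player → ℕ
  | .one => 0
  | .two => 1

theorem Player.loses_penalty (p : Player) : p.Loses p.penalty := by
  cases p <;> simp [Player.Loses, Player.penalty]

theorem Player.loses_other (p : Player) (c : ℕ) : p.other.Loses c ↔ ¬ p.Loses c := by
  cases p <;> simp [Player.Loses, Player.other]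

theorem GameGraph.wonBy_iff {V : Type} {G : GameGraph V} {p : Player} {π : ℕ → V} {m K : ℕ}
    (hm : ∀ n, ∃ k, n ≤ k ∧ G.color (π k) = m) (hK : ∀ k, K ≤ k → G.color (π k) ≤ m) :
    G.WonBy p π ↔ ¬ p.Loses m := by
  have := maxInfEven_iff hm hK
  cases p <;> simp [GameGraph.WonBy, Player.Loses, this]

/-- The colors of the simulating game. -/
def moveColor (qOwner : Q → Player) (qcol : Q → ℕ) : MoveState Q M → ℕ
  | .main q => qcol q + 2
  | .pop q _ => (qOwner q).penalty
  | .push q _ _ _ => (qOwner q).penalty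

theorem moveColor_of_not_isMain {qOwner : Q → Player} {qcol : Q → ℕ} {s : MoveState Q M}
    (hs : ¬ s.IsMain) : moveColor qOwner qcol s = (qOwner s.source).penalty := by
  cases s with
  | main q => exact (hs ⟨q, rfl⟩).elim
  | pop q m => rfl
  | push q m m' q' => rfl

variable {η : List A → M} {lm : A → M → M} {rm : M → A → M} {R : M → M → Q → M → Q → Prop}
  {qOwner : Q → Player} {qcol : Q → ℕ} {p : Player}

/-- A play that is simulated by a play according to the strategy is won. -/
theorem LocalStrategy.wonBy_of_round [Finite Q] {own : Q → Prop}
    (σ : LocalStrategy (MoveStep η lm rm R) (fun s => own s.source)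
      (moveColor qOwner qcol) p.Loses (stackType η))
    (E : List A × Q → List A × Q → Prop) {π : ℕ → List A × Q}
    (hπ : ∀ n, σ.Round ((π n).1.reverse, (π n).2) ((π (n + 1)).1.reverse, (π (n + 1)).2)) :
    (normalGame qOwner qcol E).WonBy p π := by
  obtain ⟨N, hN⟩ := (Set.finite_range qcol).bddAbove
  obtain ⟨m, hm, K, hK⟩ := exists_max_recurring (s := fun k => qcol (π k).2) (N := N)
    fun k => hN ⟨_, rfl⟩
  rw [GameGraph.wonBy_iff (G := normalGame qOwner qcol E) hm hK]
  intro hlose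
  obtain ⟨π', f, hstep, hf, hmain, hreach⟩ := exists_concat (main := fun v => v.2.IsMain)
    (step := σ.Step) (p := fun n => ((π n).1.reverse, MoveState.main (π n).2)) hπ
  obtain ⟨k, hk, -⟩ := hreach K
  refine σ.not_recurring π' (m + 2) k hstep ?_ (fun n hn => ?_) fun n => ?_
  · cases p <;> simpa [Player.Loses, Nat.even_add] using hlose
  · by_cases h : (π' n).2.IsMain
    · rw [hmain n h]
      exact Nat.add_le_add_right (hK _ (hk ▸ hf hn)) 2
    · rw [moveColor_of_not_isMain h]
      cases qOwner (π' n).2.source <;> simp [Player.penalty]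
  · obtain ⟨k, hk, hkm⟩ := hm (f n + 1)
    obtain ⟨n', hn', hπ'⟩ := hreach k
    refine ⟨n', le_of_not_gt fun h => ?_, ?_⟩
    · have := hf h.le
      omega
    · rw [hπ', ← hkm]
      rfl

/-- A progress measure on the simulating game yields a prefix-recognizable memoryless winning
strategy. -/
theorem exists_memorylessWinningFrom [Finite A] [Finite Q] [Finite M]
    {E : List A × Q → List A × Q → Prop} (htot : ∀ v, ∃ w, E v w)
    (hlm : ∀ a u, η (a :: u) = lm a (η u)) (hrm : ∀ a u, η (u ++ [a]) = rm (η u) a)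
    (hE : ∀ x q y q', E (x, q) (y, q') ↔
      ∃ w u v, x = w ++ u ∧ y = w ++ v ∧ R (η w) (η u) q (η v) q')
    {S : Set (List A × MoveState Q M)} {τ : ℕ → List A × MoveState Q M → Ordinal.{0}}
    (hS : IsProgressMeasure (fun v => qOwner v.2.source = p) (MoveStep η lm rm R)
      (fun v => moveColor qOwner qcol v.2) p.Loses S τ)
    {u₀ : List A × Q} (hu₀ : (u₀.1.reverse, .main u₀.2) ∈ S) :
    ∃ g : List A × Q → List A × Q, (∀ v, qOwner v.2 = p → E v (g v)) ∧
      MemorylessWinningFrom (normalGame qOwner qcol E) p g u₀ ∧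
      PrefixRecognizable (fun w₁ w₂ => ∃ u : List A × Q,
        qOwner u.2 = p ∧ w₁ = encode u ∧ w₂ = encode (g u)) := by
  obtain ⟨own, hown⟩ : ∃ own : Q → Prop, ∀ q, (qOwner q = p) = own q := ⟨_, fun _ => rfl⟩
  simp only [hown] at hS ⊢
  obtain ⟨σ, hσ⟩ := exists_localStrategy (ext := stackType η) (own := fun s => own s.source)
    hS isLocal_moveStep
    (fun a z h => by simpa [stackType] using congrArg Prod.fst h)
    (fun a z z' h => by
      have : η z.reverse = η z'.reverse := congrArg Prod.snd h
      simp [stackType, hrm, this])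
    (fun z z' s s' => MoveStep.stay) (fun a z z' s s' _ => MoveStep.pushes)
    (fun a b z z' s s' => MoveStep.pops) hu₀
  obtain ⟨D, hD⟩ := LocalStrategy.exists_decision (σ := σ) hrm p.loses_penalty fun s hs hm => by
    rw [moveColor_of_not_isMain hm, (hown _).mpr hs]
  have hex : ∀ q, own q → ∀ z, ∃ z₁ z₂ d, z = z₁ ++ z₂ ∧
      PopsThrough σ.h lm D q z₂ z₁ (η []) ∧ D (σ.h z₂) q (η z₁.reverse) = some d := by
    intro q hq z
    obtain ⟨⟨y, q'⟩, hy⟩ := htot (z.reverse, q)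
    obtain ⟨w, u, v, hz, rfl, hR⟩ := (hE _ _ _ _).1 hy
    have := hD.exists_popsThrough hlm hq z [] (Or.inr ⟨u.reverse, w.reverse, v, q', ?_, ?_⟩)
    · simpa using this
    · rw [← List.reverse_append, ← hz, List.reverse_reverse]
    · simpa using hR
  let g : List A × Q → List A × Q := fun u =>
    ((walk σ.h lm D u.2 u.1.reverse (η [])).1.reverse, (walk σ.h lm D u.2 u.1.reverse (η [])).2)
  have hg : ∀ v, own v.2 → E v (g v) := by
    rintro ⟨x, q⟩ hq
    obtain ⟨z₁, z₂, ⟨v, q'⟩, hx, hp, hd⟩ := hex q hq x.reverse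
    have hwalk : walk σ.h lm D q x.reverse (η []) = (v.reverse ++ z₂, q') := by
      rw [hx, walk_append hlm hp, List.append_nil, walk_of_eq_some hd]
    refine (hE _ _ _ _).2 ⟨z₂.reverse, z₁.reverse, v, ?_, ?_, ?_⟩
    · rw [← List.reverse_append, ← hx, List.reverse_reverse]
    · simp [hwalk]
    · rw [hwalk]
      exact ((hD z₂ q (η z₁.reverse) hq).1 v q' hd).1
  refine ⟨g, hg, ⟨?_, ?_⟩, ?_⟩
  · intro l v _ hl hv
    rw [liftMemoryless, hl]
    exact hg v ((hown _).mp hv)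
  · rintro π ⟨h₀, hπE⟩ hcons
    have hround : ∀ n, .main (π n).2 ∈ σ.K (σ.h (π n).1.reverse) →
        σ.Round ((π n).1.reverse, (π n).2) ((π (n + 1)).1.reverse, (π (n + 1)).2) := by
      intro n hK
      by_cases hq : own (π n).2
      · have hn := hcons n ((hown _).mpr hq)
        rw [liftMemoryless, getLast?_hist] at hn
        rw [hn]
        simpa [g] using hD.round_walk hq _ hK
      · obtain ⟨w, u, v, hx, hy, hR⟩ := (hE _ _ _ _).1 (hπE n)
        rw [hx, List.reverse_append] at hK ⊢
        rw [hy, List.reverse_append]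
        exact LocalStrategy.round_of_opp hlm hrm hq hK (by simpa using hR)
    refine σ.wonBy_of_round E fun n => hround n ?_
    induction n with
    | zero => rwa [h₀]
    | succ n ih => exact (hround n ih).mem
  · have := σ.finite
    exact prefixRecognizable_walk σ.h_cons hlm hrm D own hex

/-- A player has a prefix-recognizable memoryless winning strategy from each vertex of the winning
region. -/
theorem exists_memorylessWinningFrom_of_mem_winningRegion [Finite A] [Finite Q]
    {E : List A × Q → List A × Q → Prop} (htot : ∀ v, ∃ w, E v w)
    (hpr : PrefixRecognizable (encRel E)) {u₀ : List A × Q}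
    (hu₀ : u₀ ∈ WinningRegion (normalGame qOwner qcol E) p) :
    ∃ g : List A × Q → List A × Q, (∀ v, qOwner v.2 = p → E v (g v)) ∧
      MemorylessWinningFrom (normalGame qOwner qcol E) p g u₀ ∧
      PrefixRecognizable (fun w₁ w₂ => ∃ u : List A × Q,
        qOwner u.2 = p ∧ w₁ = encode u ∧ w₂ = encode (g u)) := by
  obtain ⟨M, _, η, lm, rm, R, hlm, hrm, hE⟩ := exists_finite_description hpr
  obtain ⟨N, hN⟩ := (Set.finite_range (moveColor (M := M) qOwner qcol)).bddAbove
  obtain ⟨S, ⟨τ, hτ⟩, τ', hτ'⟩ := exists_isProgressMeasure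
    (fun v : List A × MoveState Q M => qOwner v.2.source = p) (MoveStep η lm rm R)
    (fun v => moveColor qOwner qcol v.2) p.Loses (n := N + 1)
    fun v => Nat.lt_succ_of_le (hN ⟨_, rfl⟩)
  by_cases h₀ : (u₀.1.reverse, .main u₀.2) ∈ S
  · exact exists_memorylessWinningFrom htot hlm hrm hE hτ h₀
  · have hown : (fun v : List A × MoveState Q M => ¬ qOwner v.2.source = p) =
        fun v => qOwner v.2.source = p.other := by
      funext v
      cases p <;> cases qOwner v.2.source <;> simp [Player.other]
    have hlose : (fun c => ¬ p.Loses c) = p.other.Loses :=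
      funext fun c => propext (p.loses_other c).symm
    rw [hown, hlose] at hτ'
    obtain ⟨g, -, hg, -⟩ := exists_memorylessWinningFrom htot hlm hrm hE hτ' h₀
    obtain ⟨σ, hσ⟩ := hu₀
    exact (not_winningStrategyFrom_other hσ hg).elim

end Simulation

/-- For a normal prefix-recognizable parity game graph and a vertex `u₀` in the winning
region of a player, that player has a memoryless winning strategy from `u₀` whose graph
(restricted to her vertices) is a prefix-recognizable relation over `𝔹`. -/
theorem statement10 {A Q : Type} [Finite A] [Finite Q]
    (qOwner : Q → Player) (qcol : Q → ℕ)
    (E : (List A × Q) → (List A × Q) → Prop)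
    (htot : ∀ v, ∃ w, E v w)
    (hpr : PrefixRecognizable (encRel E))
    (u₀ : List A × Q) :
    (u₀ ∈ WinningRegion (normalGame qOwner qcol E) Player.two →
      ∃ g : List A × Q → List A × Q,
        (∀ v, qOwner v.2 = Player.two → E v (g v)) ∧
        MemorylessWinningFrom (normalGame qOwner qcol E) Player.two g u₀ ∧
        PrefixRecognizable (fun w₁ w₂ => ∃ u : List A × Q,
          qOwner u.2 = Player.two ∧ w₁ = encode u ∧ w₂ = encode (g u))) ∧
    (u₀ ∈ WinningRegion (normalGame qOwner qcol E) Player.one →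
      ∃ g : List A × Q → List A × Q,
        (∀ v, qOwner v.2 = Player.one → E v (g v)) ∧
        MemorylessWinningFrom (normalGame qOwner qcol E) Player.one g u₀ ∧
        PrefixRecognizable (fun w₁ w₂ => ∃ u : List A × Q,
          qOwner u.2 = Player.one ∧ w₁ = encode u ∧ w₂ = encode (g u))) :=
  ⟨exists_memorylessWinningFrom_of_mem_winningRegion htot hpr,
    exists_memorylessWinningFrom_of_mem_winningRegion htot hpr⟩
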